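/- arXiv:math/0405223 — 7 statements merged into one kernel-verified Lean document; each statement's English description precedes it below -/
import Mathlib

section
/- Let V be an abelian group that is a ℚ-vector space (equivalently, torsion-free and divisible), and let A ⊆ V be a subgroup. Then the torsion subgroup of the quotient group V/A is isomorphic, as an abelian group, to the tensor product A ⊗_ℤ (ℚ/ℤ). -/
open TensorProduct

/-- The group `ℚ/ℤ`. -/
abbrev RatModInt : Type := ℚ ⧸ AddSubgroup.zmultiples (1 : ℚ)

section

variable {V : Type*} [AddCommGroup V] [Module ℚ V] (A : AddSubgroup V)

/-- The homomorphism `ℚ/ℤ → V/A`, `[q] ↦ [q • a]`, attached to an element `a` of `A`. -/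
def ratModIntSMul (a : A) : RatModInt →+ V ⧸ A :=
  QuotientAddGroup.lift _ ((QuotientAddGroup.mk' A).comp ((smulAddHom ℚ V).flip (a : V))) <| by
    rw [AddSubgroup.zmultiples_le]
    simp [AddMonoidHom.mem_ker]

@[simp]
lemma ratModIntSMul_mk (a : A) (q : ℚ) :
    ratModIntSMul A a (QuotientAddGroup.mk q) = QuotientAddGroup.mk (q • (a : V)) :=
  rfl

/-- The homomorphism `A ⊗ ℚ/ℤ → V/A`, `a ⊗ [q] ↦ [q • a]`. -/
noncomputable def tensorRatModIntHom : A ⊗[ℤ] RatModInt →+ V ⧸ A :=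
  TensorProduct.liftAddHom
    (AddMonoidHom.mk' (ratModIntSMul A) fun a b ↦ by
      ext q
      simp [smul_add])
    fun n a x ↦ by
      obtain ⟨q, rfl⟩ := QuotientAddGroup.mk_surjective x
      rw [← QuotientAddGroup.mk_zsmul]
      simp [smul_comm q n]

@[simp]
lemma tensorRatModIntHom_tmul (a : A) (q : ℚ) :
    tensorRatModIntHom A (a ⊗ₜ QuotientAddGroup.mk q) = QuotientAddGroup.mk (q • (a : V)) :=
  rfl

end

lemma tmul_ratModInt_eq {A : Type*} [AddCommGroup A] (a : A) (k : ℤ) (q r : ℚ) (h : k * r = q) :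
    a ⊗ₜ[ℤ] (QuotientAddGroup.mk q : RatModInt) = (k • a) ⊗ₜ[ℤ] (QuotientAddGroup.mk r) := by
  rw [smul_tmul, ← QuotientAddGroup.mk_zsmul, zsmul_eq_mul, h]

/-- Every element of `A ⊗ ℚ/ℤ` is a pure tensor `a ⊗ [1/n]`. -/
lemma exists_eq_tmul_inv_ratModInt {A : Type*} [AddCommGroup A] (t : A ⊗[ℤ] RatModInt) :
    ∃ (a : A) (n : ℕ), n ≠ 0 ∧ t = a ⊗ₜ[ℤ] (QuotientAddGroup.mk (n : ℚ)⁻¹ : RatModInt) := by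
  induction t with
  | zero => exact ⟨0, 1, one_ne_zero, by simp⟩
  | tmul a x =>
    obtain ⟨q, rfl⟩ := QuotientAddGroup.mk_surjective x
    exact ⟨q.num • a, q.den, q.den_ne_zero,
      tmul_ratModInt_eq a _ _ _ (by rw [← div_eq_mul_inv, Rat.num_div_den])⟩
  | add x y hx hy =>
    obtain ⟨a, m, hm, rfl⟩ := hx
    obtain ⟨b, n, hn, rfl⟩ := hy
    refine ⟨(n : ℤ) • a + (m : ℤ) • b, m * n, mul_ne_zero hm hn, ?_⟩
    rw [add_tmul, ← tmul_ratModInt_eq a n (m : ℚ)⁻¹, ← tmul_ratModInt_eq b m (n : ℚ)⁻¹] <;>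
    · push_cast
      field_simp

section

variable {V : Type*} [AddCommGroup V] [Module ℚ V] (A : AddSubgroup V)

lemma tensorRatModIntHom_injective : Function.Injective (tensorRatModIntHom A) := by
  rw [injective_iff_map_eq_zero]
  intro t ht
  obtain ⟨a, n, hn, rfl⟩ := exists_eq_tmul_inv_ratModInt t
  rw [tensorRatModIntHom_tmul, QuotientAddGroup.eq_zero_iff] at ht
  have hn' : (n : ℚ) ≠ 0 := Nat.cast_ne_zero.mpr hn
  have ha : a = (n : ℤ) • (⟨(n : ℚ)⁻¹ • (a : V), ht⟩ : A) := by
    ext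
    rw [AddSubgroup.coe_zsmul, natCast_zsmul, ← Nat.cast_smul_eq_nsmul ℚ, smul_inv_smul₀ hn']
  have h1 : (QuotientAddGroup.mk (1 : ℚ) : RatModInt) = 0 :=
    (QuotientAddGroup.eq_zero_iff _).mpr (AddSubgroup.mem_zmultiples 1)
  rw [ha, ← tmul_ratModInt_eq _ n 1 _ (by push_cast; exact mul_inv_cancel₀ hn'), h1, tmul_zero]

lemma range_tensorRatModIntHom :
    (tensorRatModIntHom A).range = AddCommGroup.torsion (V ⧸ A) := by
  ext x
  constructor
  · rintro ⟨t, rfl⟩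
    obtain ⟨a, n, hn, rfl⟩ := exists_eq_tmul_inv_ratModInt t
    refine isOfFinAddOrder_iff_nsmul_eq_zero.mpr ⟨n, Nat.pos_of_ne_zero hn, ?_⟩
    rw [tensorRatModIntHom_tmul, ← QuotientAddGroup.mk_nsmul, ← Nat.cast_smul_eq_nsmul ℚ,
      smul_inv_smul₀ (Nat.cast_ne_zero.mpr hn)]
    exact (QuotientAddGroup.eq_zero_iff _).mpr a.2
  · intro hx
    obtain ⟨n, hn, h⟩ := isOfFinAddOrder_iff_nsmul_eq_zero.mp hx
    obtain ⟨v, rfl⟩ := QuotientAddGroup.mk_surjective x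
    rw [← QuotientAddGroup.mk_nsmul, QuotientAddGroup.eq_zero_iff, ← Nat.cast_smul_eq_nsmul ℚ] at h
    refine ⟨(⟨(n : ℚ) • v, h⟩ : A) ⊗ₜ QuotientAddGroup.mk (n : ℚ)⁻¹, ?_⟩
    rw [tensorRatModIntHom_tmul,
      inv_smul_smul₀ (Nat.cast_ne_zero.mpr hn.ne')]

end

/-- If `V` is a `ℚ`-vector space and `A ⊆ V` a subgroup, then the torsion subgroup of
`V/A` is isomorphic to `A ⊗_ℤ ℚ/ℤ`. -/
theorem torsion_quotient_iso_tensor_ratModInt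
    (V : Type*) [AddCommGroup V] [Module ℚ V] (A : AddSubgroup V) :
    Nonempty ((AddCommGroup.torsion (V ⧸ A)) ≃+ (A ⊗[ℤ] RatModInt)) :=
  ⟨((AddMonoidHom.ofInjective (tensorRatModIntHom_injective A)).trans
    (AddEquiv.addSubgroupCongr (range_tensorRatModIntHom A))).symm⟩
end

section
/- Let 0 → A → V → H → M → 0 be an exact sequence of abelian groups in which V is a ℚ-vector space (equivalently, torsion-free and divisible). Then the torsion subgroup of H is isomorphic, as an abelian group, to the direct sum of A ⊗_ℤ (ℚ/ℤ) and the torsion subgroup of M. -/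
open TensorProduct

namespace RatModInt

/-- Every element of `A ⊗ ℚ/ℤ` is a pure tensor `a ⊗ [1/n]` with `n` a positive integer. -/
lemma exists_eq_tmul_inv {A : Type*} [AddCommGroup A] (x : A ⊗[ℤ] RatModInt) :
    ∃ (a : A) (n : ℕ), n ≠ 0 ∧ x = a ⊗ₜ[ℤ] (((n : ℚ)⁻¹ : ℚ) : RatModInt) := by
  induction x with
  | zero => exact ⟨0, 1, one_ne_zero, (zero_tmul _ _).symm⟩
  | tmul a q =>
    induction q using QuotientAddGroup.induction_on with
    | H q =>
      refine ⟨q.num • a, q.den, q.den_nz, ?_⟩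
      rw [smul_tmul, ← QuotientAddGroup.mk_zsmul, zsmul_eq_mul, ← div_eq_mul_inv, Rat.num_div_den]
  | add x y hx hy =>
    obtain ⟨a, m, hm, rfl⟩ := hx
    obtain ⟨b, n, hn, rfl⟩ := hy
    refine ⟨(n : ℤ) • a + (m : ℤ) • b, m * n, mul_ne_zero hm hn, ?_⟩
    have hm' : (m : ℚ) ≠ 0 := mod_cast hm
    have hn' : (n : ℚ) ≠ 0 := mod_cast hn
    rw [add_tmul, smul_tmul, smul_tmul, ← QuotientAddGroup.mk_zsmul, ← QuotientAddGroup.mk_zsmul]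
    congr 4 <;> push_cast <;> simp <;> field_simp

/-- The group `A ⊗ ℚ/ℤ` is divisible. -/
lemma smul_surjective_tensorProduct (A : Type*) [AddCommGroup A] {k : ℤ} (hk : k ≠ 0) :
    Function.Surjective (k • · : A ⊗[ℤ] RatModInt → A ⊗[ℤ] RatModInt) := by
  intro x
  obtain ⟨a, n, -, rfl⟩ := exists_eq_tmul_inv x
  refine ⟨a ⊗ₜ[ℤ] (((k : ℚ)⁻¹ * (n : ℚ)⁻¹ : ℚ) : RatModInt), ?_⟩
  have hk' : (k : ℚ) ≠ 0 := mod_cast hk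
  dsimp only
  rw [← tmul_smul, ← QuotientAddGroup.mk_zsmul, zsmul_eq_mul, mul_inv_cancel_left₀ hk']

variable {A V H : Type*} [AddCommGroup A] [AddCommGroup V] [Module ℚ V] [AddCommGroup H]
  (f : A →+ V) (g : V →+ H)

/-- For `g ∘ f = 0` with `V` a `ℚ`-vector space, the map `A ⊗ ℚ/ℤ → H` sending `a ⊗ [q]` to
`g (q • f a)`. -/
noncomputable def tensorLift (hgf : f.range ≤ g.ker) : A ⊗[ℤ] RatModInt →+ H :=
  TensorProduct.liftAddHom
    (AddMonoidHom.mk'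
      (fun a ↦ QuotientAddGroup.lift (AddSubgroup.zmultiples (1 : ℚ))
        (g.comp ((smulAddHom ℚ V).flip (f a)))
        (AddSubgroup.zmultiples_le.2 <| by
          simpa [AddMonoidHom.mem_ker] using hgf ⟨a, rfl⟩))
      (fun a b ↦ QuotientAddGroup.addMonoidHom_ext _ <| by ext; simp))
    (fun k a q ↦ by
      simp only [map_zsmul, AddMonoidHom.smul_apply])

variable {f g}

@[simp]
lemma tensorLift_tmul (hgf : f.range ≤ g.ker) (a : A) (q : ℚ) :
    tensorLift f g hgf (a ⊗ₜ[ℤ] (q : RatModInt)) = g (q • f a) :=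
  rfl

lemma tensorLift_injective (hf : Function.Injective f) (hgf : f.range = g.ker) :
    Function.Injective (tensorLift f g hgf.le) := by
  rw [injective_iff_map_eq_zero]
  intro x hx
  obtain ⟨a, n, hn, rfl⟩ := exists_eq_tmul_inv x
  have hn' : (n : ℚ) ≠ 0 := mod_cast hn
  rw [tensorLift_tmul, ← AddMonoidHom.mem_ker, ← hgf] at hx
  obtain ⟨b, hb⟩ := hx
  obtain rfl : a = (n : ℤ) • b := hf <| by
    rw [map_zsmul, hb, natCast_zsmul, ← Nat.cast_smul_eq_nsmul ℚ, smul_inv_smul₀ hn']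
  rw [smul_tmul, ← QuotientAddGroup.mk_zsmul, zsmul_eq_mul, Int.cast_natCast, mul_inv_cancel₀ hn',
    (QuotientAddGroup.eq_zero_iff _).2 (AddSubgroup.mem_zmultiples _), tmul_zero]

/-- The image of `A ⊗ ℚ/ℤ` in `H` consists of the torsion elements in the image of `V`. -/
lemma range_tensorLift (hgf : f.range = g.ker) :
    (tensorLift f g hgf.le).range = AddCommGroup.torsion H ⊓ g.range := by
  ext x
  constructor
  · rintro ⟨y, rfl⟩
    obtain ⟨a, n, hn, rfl⟩ := exists_eq_tmul_inv y
    have hn' : (n : ℚ) ≠ 0 := mod_cast hn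
    refine ⟨isOfFinAddOrder_iff_nsmul_eq_zero.2 ⟨n, Nat.pos_of_ne_zero hn, ?_⟩, _, rfl⟩
    rw [tensorLift_tmul, ← map_nsmul, ← Nat.cast_smul_eq_nsmul ℚ, smul_inv_smul₀ hn']
    exact hgf.le ⟨a, rfl⟩
  · rintro ⟨hx, v, rfl⟩
    obtain ⟨n, hn, hv⟩ := isOfFinAddOrder_iff_nsmul_eq_zero.1 hx
    have hn' : (n : ℚ) ≠ 0 := mod_cast hn.ne'
    rw [← map_nsmul, ← AddMonoidHom.mem_ker, ← hgf] at hv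
    obtain ⟨a, ha⟩ := hv
    refine ⟨a ⊗ₜ[ℤ] (((n : ℚ)⁻¹ : ℚ) : RatModInt), ?_⟩
    rw [tensorLift_tmul, ha, ← Nat.cast_smul_eq_nsmul ℚ, inv_smul_smul₀ hn']

end RatModInt

/-- If the kernel of `h : H → M` is the image of a `ℚ`-vector space, then torsion elements of `M`
in the image of `h` lift to torsion elements of `H`. -/
lemma exists_mem_torsion_map_eq {V H M : Type*} [AddCommGroup V] [Module ℚ V]
    [AddCommGroup H] [AddCommGroup M] {g : V →+ H} {h : H →+ M} (hhg : g.range = h.ker)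
    (hh : Function.Surjective h) {m : M} (hm : m ∈ AddCommGroup.torsion M) :
    ∃ x ∈ AddCommGroup.torsion H, h x = m := by
  obtain ⟨n, hn, hnm⟩ := isOfFinAddOrder_iff_nsmul_eq_zero.1 hm
  obtain ⟨x, rfl⟩ := hh m
  have hn' : (n : ℚ) ≠ 0 := mod_cast hn.ne'
  rw [← map_nsmul, ← AddMonoidHom.mem_ker, ← hhg] at hnm
  obtain ⟨v, hv⟩ := hnm
  refine ⟨x - g ((n : ℚ)⁻¹ • v), isOfFinAddOrder_iff_nsmul_eq_zero.2 ⟨n, hn, ?_⟩, ?_⟩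
  · rw [smul_sub, ← map_nsmul, ← Nat.cast_smul_eq_nsmul ℚ n (_ : V), smul_inv_smul₀ hn', hv,
      sub_self]
  · rw [map_sub, AddMonoidHom.mem_ker.1 (hhg.le ⟨_, rfl⟩), sub_zero]

/-- A short exact sequence of abelian groups whose first term is divisible splits. -/
lemma nonempty_addEquiv_prod_of_divisible {D E F : Type*} [AddCommGroup D] [AddCommGroup E]
    [AddCommGroup F] (hD : ∀ {k : ℤ}, k ≠ 0 → Function.Surjective (k • · : D → D))
    {i : D →+ E} {p : E →+ F} (hi : Function.Injective i) (hip : i.range = p.ker)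
    (hp : Function.Surjective p) : Nonempty (E ≃+ D × F) := by
  let _ : DivisibleBy D ℤ := divisibleByOfSMulRightSurj D ℤ hD
  obtain ⟨r, hr⟩ := (Module.Baer.of_divisible D).extension_property_addMonoidHom i hi (.id D)
  have hri (d : D) : r (i d) = d := DFunLike.congr_fun hr d
  have hpi (d : D) : p (i d) = 0 := hip.le ⟨d, rfl⟩
  refine ⟨AddEquiv.ofBijective (r.prod p) ⟨?_, ?_⟩⟩
  · rw [injective_iff_map_eq_zero]
    intro x hx
    obtain ⟨hrx, hpx⟩ := Prod.ext_iff.1 hx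
    obtain ⟨d, rfl⟩ := hip.ge hpx
    have : d = 0 := (hri d).symm.trans hrx
    rw [this, map_zero]
  · rintro ⟨d, y⟩
    obtain ⟨x, rfl⟩ := hp y
    refine ⟨x + i (d - r x), Prod.ext ?_ ?_⟩ <;> simp [hri, hpi]

/-- Given an exact sequence `0 → A → V → H → M → 0` of abelian groups with `V` a
`ℚ`-vector space, the torsion subgroup of `H` is isomorphic to the direct sum of
`A ⊗_ℤ ℚ/ℤ` and the torsion subgroup of `M`. -/
theorem torsion_iso_tensor_prod_torsion
    (A V H M : Type*) [AddCommGroup A] [AddCommGroup V] [Module ℚ V]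
    [AddCommGroup H] [AddCommGroup M]
    (f : A →+ V) (g : V →+ H) (h : H →+ M)
    (hf : Function.Injective f) (hgf : f.range = g.ker) (hhg : g.range = h.ker)
    (hh : Function.Surjective h) :
    Nonempty ((AddCommGroup.torsion H) ≃+
      ((A ⊗[ℤ] RatModInt) × AddCommGroup.torsion M)) := by
  have hrange := RatModInt.range_tensorLift hgf
  refine nonempty_addEquiv_prod_of_divisible (RatModInt.smul_surjective_tensorProduct A)
    (i := (RatModInt.tensorLift f g hgf.le).codRestrict (AddCommGroup.torsion H)
      fun x ↦ (hrange.le ⟨x, rfl⟩).1)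
    (p := (h.comp (AddCommGroup.torsion H).subtype).codRestrict (AddCommGroup.torsion M)
      fun x ↦ h.isOfFinAddOrder x.2) ?_ ?_ ?_
  · exact fun x y hxy ↦ RatModInt.tensorLift_injective hf hgf (Subtype.ext_iff.1 hxy)
  · ext ⟨x, hx⟩
    have hxr := SetLike.ext_iff.1 hrange x
    rw [AddSubgroup.mem_inf, hhg, and_iff_right hx] at hxr
    refine (exists_congr fun y ↦ Subtype.ext_iff).trans (hxr.trans ?_)
    exact (AddSubgroup.mk_eq_zero (H := AddCommGroup.torsion M)
      (h := h.isOfFinAddOrder hx)).symm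
  · rintro ⟨m, hm⟩
    obtain ⟨x, hx, rfl⟩ := exists_mem_torsion_map_eq hhg hh hm
    exact ⟨⟨x, hx⟩, rfl⟩
end

section
/- Let G be a polycyclic group and let M be a G-module whose underlying abelian group is finite. Then the group cohomology H^p(G, M) is a finite group for every integer p ≥ 0. -/
/-- A group is polycyclic if it is solvable and all its subgroups are finitely
generated. -/
def IsPolycyclic (G : Type*) [Group G] : Prop :=
  IsSolvable G ∧ ∀ H : Subgroup G, H.FG

open CategoryTheory

lemma Int.exists_sub_one_sub_eq {A : Type*} [AddCommGroup A] (U : ℤ → A) :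
    ∃ u : ℤ → A, ∀ n, u (n - 1) - u n = U n := by
  refine ⟨fun n ↦ ∑ i ∈ Finset.Ioc n 0, U i - ∑ i ∈ Finset.Ioc 0 n, U i, fun n ↦ ?_⟩
  rcases le_or_gt n 0 with hn | hn
  · have h : Finset.Ioc (n - 1) 0 = insert n (Finset.Ioc n 0) := by
      ext i
      simp only [Finset.mem_Ioc, Finset.mem_insert]
      lia
    simp [h, Finset.Ioc_eq_empty_of_le hn, Finset.Ioc_eq_empty_of_le (show n - 1 ≤ 0 by lia)]
  · have h : Finset.Ioc 0 n = insert n (Finset.Ioc 0 (n - 1)) := by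
      ext i
      simp only [Finset.mem_Ioc, Finset.mem_insert]
      lia
    simp [h, Finset.Ioc_eq_empty_of_le hn.le, Finset.Ioc_eq_empty_of_le (show 0 ≤ n - 1 by lia)]

lemma CategoryTheory.ShortComplex.Exact.finite_moduleCat {R : Type*} [Ring R]
    {S : ShortComplex (ModuleCat R)} (hS : S.Exact) [Finite S.X₁] [Finite S.X₃] :
    Finite S.X₂ := by
  have : Finite (LinearMap.ker S.g.hom) := by
    rw [← hS.moduleCat_range_eq_ker]
    exact Set.finite_range S.f.hom
  have : Finite (LinearMap.range S.g.hom) := inferInstance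
  exact S.g.hom.toAddMonoidHom.finite_iff_finite_ker_range.2 ⟨‹_›, ‹_›⟩

namespace Rep

variable {k G : Type} [CommRing k] [Group G]

lemma shortExact_mk {A B C : Rep k G} (f : A ⟶ B) (g : B ⟶ C)
    (w : f ≫ g = 0) (hf : Function.Injective f.hom)
    (hfg : ∀ b, g.hom b = 0 → ∃ a, f.hom a = b) (hg : Function.Surjective g.hom) :
    (ShortComplex.mk f g w).ShortExact where
  exact := by
    rw [← ShortComplex.exact_map_iff_of_faithful _ (forget₂ (Rep k G) (ModuleCat k)),
      ShortComplex.moduleCat_exact_iff]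
    exact hfg
  mono_f := (mono_iff_injective f).2 hf
  epi_g := (epi_iff_surjective g).2 hg

/-- The embedding `m ↦ (g ↦ g • m)` of a representation into the coinduction of its restriction
to a subgroup. -/
noncomputable abbrev toCoindRes (S : Subgroup G) (M : Rep k G) :
    M ⟶ coind S.subtype (res S.subtype M) :=
  resCoindToHom _ M _ (𝟙 _)

lemma toCoindRes_apply (S : Subgroup G) (M : Rep k G) (m : M) (g : G) :
    ((toCoindRes S M).hom m).1 g = M.ρ g m := rfl

lemma toCoindRes_injective (S : Subgroup G) (M : Rep k G) :
    Function.Injective (toCoindRes S M).hom := by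
  intro m n h
  simpa [toCoindRes_apply] using congr_fun (congr_arg Subtype.val h) 1

lemma finite_coind (S : Subgroup G) [S.FiniteIndex] (A : Rep k S) [Finite A] :
    Finite (coind S.subtype A) := by
  have : Finite (Quotient (QuotientGroup.rightRel S)) :=
    Finite.of_equiv _ (QuotientGroup.quotientRightRelEquivQuotientLeftRel S).symm
  refine Finite.of_injective (β := Quotient (QuotientGroup.rightRel S) → A)
    (fun f q ↦ f.1 q.out) fun f f' h ↦ Subtype.ext (funext fun g ↦ ?_)
  have hg := QuotientGroup.rightRel_apply.1 (Quotient.mk_out (s := QuotientGroup.rightRel S) g)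
  have key (f : coind S.subtype A) := f.2 ⟨_, hg⟩ (Quotient.mk (QuotientGroup.rightRel S) g).out
  simp only [Subgroup.subtype_apply, inv_mul_cancel_right] at key
  rw [key, key]
  exact congr_arg _ (congr_fun h _)

/-- The endomorphism `f ↦ (g ↦ t • f (t⁻¹ * g) - f g)` of the coinduction of the restriction of
`M` to a normal subgroup. -/
noncomputable def coindResSubId (S : Subgroup G) [S.Normal] (M : Rep k G) (t : G) :
    coind S.subtype (res S.subtype M) ⟶ coind S.subtype (res S.subtype M) :=
  ofHom
    { toFun f := ⟨fun g ↦ M.ρ t (f.1 (t⁻¹ * g)) - f.1 g, fun s g ↦ by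
        have h₁ := f.2 ⟨t⁻¹ * s * t, by
          simpa using (inferInstance : S.Normal).conj_mem s s.2 t⁻¹⟩ (t⁻¹ * g)
        have h₂ := f.2 s g
        simp only [Subgroup.subtype_apply, mul_assoc, mul_inv_cancel_left] at h₁ h₂ ⊢
        rw [h₁, h₂]
        simp [← Module.End.mul_apply, ← map_mul]⟩
      map_add' f f' := by ext g; simp; abel
      map_smul' c f := by ext g; simp [smul_sub]
      isIntertwining' h := by
        ext f g
        change M.ρ t (f.1 (t⁻¹ * g * h)) - f.1 (g * h) =
          M.ρ t (f.1 (t⁻¹ * (g * h))) - f.1 (g * h)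
        rw [mul_assoc] }

lemma coindResSubId_apply (S : Subgroup G) [S.Normal] (M : Rep k G) (t : G)
    (f : coind S.subtype (res S.subtype M)) (g : G) :
    ((coindResSubId S M t).hom f).1 g = M.ρ t (f.1 (t⁻¹ * g)) - f.1 g := rfl

lemma toCoindRes_comp_coindResSubId (S : Subgroup G) [S.Normal] (M : Rep k G) (t : G) :
    toCoindRes S M ≫ coindResSubId S M t = 0 := by
  ext m g
  change M.ρ t (M.ρ (t⁻¹ * g) m) - M.ρ g m = 0
  simp [← Module.End.mul_apply, ← map_mul]

lemma shortExact_toCoindRes_coindResSubId (φ : G →* Multiplicative ℤ) {t : G}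
    (ht : φ t = Multiplicative.ofAdd 1) (M : Rep k G) :
    (ShortComplex.mk _ _ (toCoindRes_comp_coindResSubId φ.ker M t)).ShortExact := by
  have hker (g : G) : g * (t ^ (φ g).toAdd)⁻¹ ∈ φ.ker := by
    simp [MonoidHom.mem_ker, ht, ← ofAdd_zsmul]
  refine shortExact_mk _ _ _ (toCoindRes_injective _ _) (fun f hf ↦ ?_) fun F ↦ ?_
  · have hf' (g : G) : M.ρ t (f.1 (t⁻¹ * g)) = f.1 g :=
      sub_eq_zero.1 (congr_fun (congr_arg Subtype.val hf) g)
    let K : Subgroup G :=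
      { carrier := {x | ∀ g, f.1 (x * g) = M.ρ x (f.1 g)}
        one_mem' := by simp
        mul_mem' {x y} hx hy g := by simp [mul_assoc, hx (y * g), hy g]
        inv_mem' {x} hx g := by
          have := hx (x⁻¹ * g)
          rw [mul_inv_cancel_left] at this
          simp [this] }
    have htK : t ∈ K := fun g ↦ by simpa using (hf' (t * g)).symm
    refine ⟨f.1 1, Subtype.ext (funext fun g ↦ ?_)⟩
    have hgK : g ∈ K := by
      have h₁ : g * (t ^ (φ g).toAdd)⁻¹ ∈ K := fun x ↦ f.2 ⟨_, hker g⟩ x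
      simpa using K.mul_mem h₁ (K.zpow_mem htK (φ g).toAdd)
    simpa [toCoindRes_apply] using (hgK 1).symm
  · obtain ⟨u, hu⟩ := Int.exists_sub_one_sub_eq fun n ↦ M.ρ (t ^ n)⁻¹ (F.1 (t ^ n))
    refine ⟨⟨fun g ↦ M.ρ g (u (φ g).toAdd), fun s g ↦ ?_⟩, Subtype.ext (funext fun g ↦ ?_)⟩
    · have hs : φ s = 1 := s.2
      simp [hs]
    · rw [coindResSubId_apply]
      have h₁ : (φ (t⁻¹ * g)).toAdd = (φ g).toAdd - 1 := by
        simp [ht]; ring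
      have h₂ := F.2 ⟨_, hker g⟩ (t ^ (φ g).toAdd)
      simp only [Subgroup.subtype_apply, inv_mul_cancel_right] at h₂
      simp only [h₁]
      rw [← Module.End.mul_apply, ← map_mul, mul_inv_cancel_left, ← map_sub, hu,
        ← Module.End.mul_apply, ← map_mul, h₂]
      rfl

end Rep

namespace groupCohomology

variable {k G : Type} [CommRing k] [Group G]

lemma finite_zero (M : Rep k G) [Finite M] : Finite (groupCohomology M 0) :=
  Finite.of_injective _ (H0Iso M).toLinearEquiv.injective

lemma finite_succ_of_shortExact {X : ShortComplex (Rep k G)} (hX : X.ShortExact) (p : ℕ)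
    (h₃ : Finite (groupCohomology X.X₃ p)) (h₂ : Finite (groupCohomology X.X₂ (p + 1))) :
    Finite (groupCohomology X.X₁ (p + 1)) :=
  have : Finite (mapShortComplex₁ hX rfl).X₁ := h₃
  have : Finite (mapShortComplex₁ hX rfl).X₃ := h₂
  (mapShortComplex₁_exact hX (rfl : p + 1 = p + 1)).finite_moduleCat

lemma finite_of_subsingleton [Subsingleton G] (M : Rep k G) [Finite M] (p : ℕ) :
    Finite (groupCohomology M p) := by
  have : Finite (cocycles M p) :=
    Finite.of_injective (iCocycles M p) ((ModuleCat.mono_iff_injective _).1 inferInstance)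
  exact Finite.of_surjective (π M p) fun x ↦ groupCohomology_induction_on x fun y ↦ ⟨y, rfl⟩

/-- Group cohomology is invariant under restriction along a group isomorphism. -/
noncomputable def resIso {H : Type} [Group H] (e : G ≃* H) (M : Rep k H) (p : ℕ) :
    groupCohomology (Rep.res e.toMonoidHom M) p ≅ groupCohomology M p :=
  mapIso (A := M) (B := Rep.res e.toMonoidHom M) e (LinearEquiv.refl k M) (fun _ ↦ rfl) p

end groupCohomology

/-- All cohomology groups of `G` with finite coefficients are finite. -/
def HasFiniteCohomology (G : Type) [Group G] : Prop :=
  ∀ (M : Rep ℤ G) [Finite M] (p : ℕ), Finite (groupCohomology M p)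

namespace HasFiniteCohomology

variable {G : Type} [Group G]

lemma of_mulEquiv {H : Type} [Group H] (e : G ≃* H) (hG : HasFiniteCohomology G) :
    HasFiniteCohomology H := fun M _ p ↦
  have : Finite (Rep.res e.toMonoidHom M) := ‹Finite M›
  have := hG (Rep.res e.toMonoidHom M) p
  Finite.of_equiv _ (groupCohomology.resIso e M p).toLinearEquiv.toEquiv

lemma finite_coind {S : Subgroup G} (hS : HasFiniteCohomology S) (A : Rep ℤ S) [Finite A] (p : ℕ) :
    Finite (groupCohomology (Rep.coind S.subtype A) p) :=
  have := hS A p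
  Finite.of_equiv _ (groupCohomology.coindIso A p).symm.toLinearEquiv.toEquiv

lemma of_finiteIndex (S : Subgroup G) [S.FiniteIndex] (hS : HasFiniteCohomology S) :
    HasFiniteCohomology G := by
  intro M _ p
  induction p generalizing M with
  | zero => exact groupCohomology.finite_zero M
  | succ p ih =>
    have : Finite (Rep.res S.subtype M) := ‹Finite M›
    have := Rep.finite_coind S (Rep.res S.subtype M)
    let ι := Rep.toCoindRes S M
    have : Mono ι := (Rep.mono_iff_injective _).2 (Rep.toCoindRes_injective S M)
    have : Finite (Limits.cokernel ι : Rep ℤ G) :=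
      Finite.of_surjective (Limits.cokernel.π ι).hom ((Rep.epi_iff_surjective _).1 inferInstance)
    have hX : (ShortComplex.mk ι (Limits.cokernel.π ι) (Limits.cokernel.condition ι)).ShortExact :=
      { exact := ShortComplex.exact_cokernel ι }
    exact groupCohomology.finite_succ_of_shortExact hX p (ih _) (hS.finite_coind _ _)

lemma of_ker (φ : G →* Multiplicative ℤ) (hφ : Function.Surjective φ)
    (hS : HasFiniteCohomology φ.ker) : HasFiniteCohomology G := by
  intro M _ p
  obtain ⟨t, ht⟩ := hφ (Multiplicative.ofAdd 1)
  cases p with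
  | zero => exact groupCohomology.finite_zero M
  | succ p =>
    have : Finite (Rep.res φ.ker.subtype M) := ‹Finite M›
    exact groupCohomology.finite_succ_of_shortExact
      (Rep.shortExact_toCoindRes_coindResSubId φ ht M) p (hS.finite_coind _ _) (hS.finite_coind _ _)

lemma of_isCyclic_quotient (N : Subgroup G) [N.Normal] [IsCyclic (G ⧸ N)]
    (hN : HasFiniteCohomology N) : HasFiniteCohomology G := by
  cases finite_or_infinite (G ⧸ N) with
  | inl h =>
    have : N.FiniteIndex := Subgroup.finiteIndex_of_finite_quotient
    exact of_finiteIndex N hN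
  | inr h =>
    let e : G ⧸ N ≃* Multiplicative ℤ := intCyclicMulEquiv.symm
    let φ : G →* Multiplicative ℤ := e.toMonoidHom.comp (QuotientGroup.mk' N)
    have hφ : φ.ker = N :=
      (MonoidHom.ker_mulEquiv_comp _ e).trans (QuotientGroup.ker_mk' N)
    exact of_ker φ (e.surjective.comp (QuotientGroup.mk'_surjective N))
      (hN.of_mulEquiv (MulEquiv.subgroupCongr hφ.symm))

lemma sup_zpowers {L : Subgroup G} (x : G)
    (hx : ⁅L ⊔ Subgroup.zpowers x, L ⊔ Subgroup.zpowers x⁆ ≤ L) (hL : HasFiniteCohomology L) :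
    HasFiniteCohomology (L ⊔ Subgroup.zpowers x : Subgroup G) := by
  set L' := L ⊔ Subgroup.zpowers x
  have hLL' : L ≤ L' := le_sup_left
  have hxL' : x ∈ L' := Subgroup.mem_sup_right (Subgroup.mem_zpowers x)
  let N := L.subgroupOf L'
  have : N.Normal := (Subgroup.normal_subgroupOf_iff_le_normalizer hLL').2 <|
    Subgroup.le_normalizer_iff_commutator_le_left.2 ((Subgroup.commutator_mono hLL' le_rfl).trans hx)
  have : IsCyclic (L' ⧸ N) := by
    let C := Subgroup.zpowers (QuotientGroup.mk' N ⟨x, hxL'⟩)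
    have hle : L' ≤ (C.comap (QuotientGroup.mk' N)).map L'.subtype := by
      refine sup_le (fun y hy ↦ ⟨⟨y, hLL' hy⟩, ?_, rfl⟩)
        (Subgroup.zpowers_le.2 ⟨⟨x, hxL'⟩, Subgroup.mem_zpowers _, rfl⟩)
      have h : QuotientGroup.mk' N ⟨y, hLL' hy⟩ = 1 := (QuotientGroup.eq_one_iff _).2 hy
      simp only [Subgroup.coe_comap, Set.mem_preimage, h]
      exact one_mem C
    refine ⟨QuotientGroup.mk' N ⟨x, hxL'⟩, fun q ↦ ?_⟩
    obtain ⟨y, rfl⟩ := QuotientGroup.mk'_surjective N q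
    obtain ⟨z, hz, hzy⟩ := hle y.2
    obtain rfl : z = y := Subtype.ext hzy
    exact hz
  exact of_isCyclic_quotient N (hL.of_mulEquiv (Subgroup.subgroupOfEquivOfLe hLL').symm)

lemma of_commutator {H : Subgroup G} (hfg : H.FG) (hH : HasFiniteCohomology (⁅H, H⁆ : Subgroup G)) :
    HasFiniteCohomology H := by
  classical
  obtain ⟨s, hs⟩ := hfg
  have key (s : Finset G) : (s : Set G) ⊆ H →
      HasFiniteCohomology (⁅H, H⁆ ⊔ Subgroup.closure (s : Set G) : Subgroup G) := by
    induction s using Finset.induction with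
    | empty =>
      rw [Finset.coe_empty, Subgroup.closure_empty, sup_bot_eq]
      exact fun _ ↦ hH
    | insert x s _ ih =>
      intro hxs
      rw [Finset.coe_insert, Set.insert_subset_iff] at hxs
      have h : ⁅H, H⁆ ⊔ Subgroup.closure ((insert x s : Finset G) : Set G) =
          ⁅H, H⁆ ⊔ Subgroup.closure (s : Set G) ⊔ Subgroup.zpowers x := by
        rw [Finset.coe_insert, Set.insert_eq, Subgroup.closure_union,
          Subgroup.zpowers_eq_closure, sup_assoc, sup_comm (Subgroup.closure {x})]
      have hle : ⁅H, H⁆ ⊔ Subgroup.closure (s : Set G) ⊔ Subgroup.zpowers x ≤ H :=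
        sup_le (sup_le H.commutator_le_self (by simpa using hxs.2)) (by simpa using hxs.1)
      rw [h]
      exact sup_zpowers x ((Subgroup.commutator_mono hle hle).trans le_sup_left) (ih hxs.2)
  have h : ⁅H, H⁆ ⊔ Subgroup.closure (s : Set G) = H := by
    rw [hs]
    exact sup_eq_right.2 H.commutator_le_self
  exact h ▸ key s (hs ▸ Subgroup.subset_closure)

lemma of_isPolycyclic (hG : IsPolycyclic G) : HasFiniteCohomology G := by
  obtain ⟨⟨n, hn⟩, hfg⟩ := hG
  have key (m : ℕ) (hm : m ≤ n) : HasFiniteCohomology (derivedSeries G m) := by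
    induction hm using Nat.decreasingInduction with
    | self =>
      rw [hn]
      exact fun M _ p ↦ groupCohomology.finite_of_subsingleton M p
    | of_succ m _ ih => exact of_commutator (hfg _) ih
  exact (key 0 n.zero_le).of_mulEquiv Subgroup.topEquiv

end HasFiniteCohomology

/-- If `G` is polycyclic and `M` is a `G`-module that is finite as an abelian group,
then the group cohomology `H^p(G, M)` is finite for all `p ≥ 0`. -/
theorem groupCohomology_finite_of_polycyclic
    (G : Type) [Group G] (hG : IsPolycyclic G)
    (M : Rep ℤ G) [Finite M] (p : ℕ) :
    Finite (groupCohomology M p) := by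
  exact HasFiniteCohomology.of_isPolycyclic hG M p
end

section
/- Let G be a group containing a polycyclic subgroup of finite index. Then for every 2-cocycle μ : G × G → ℂˣ (for the trivial G-action) that is torsion modulo coboundaries, there exist an integer r ≥ 1, a function ρ : G → GL_r(ℂ), and a function c : G → ℂˣ such that ρ(g)·ρ(h) = (μ(g,h)·c(g)·c(h)·c(gh)⁻¹) • ρ(gh) for all g, h ∈ G; that is, up to a coboundary, μ is the obstruction cocycle of a projective representation of G. -/
/-- The property that all subgroups are finitely generated lifts along homomorphisms with
finite kernel. -/
theorem Subgroup.forall_fg_of_finite_ker {E P : Type*} [Group E] [Group P] (f : E →* P)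
    (hf : Finite f.ker) (hP : ∀ H : Subgroup P, H.FG) (H : Subgroup E) : H.FG := by
  classical
  obtain ⟨S, hS⟩ := hP (H.map f)
  have hSH : (S : Set P) ⊆ f '' (H : Set E) := by
    rw [← Subgroup.coe_map, ← hS]
    exact Subgroup.subset_closure
  obtain ⟨T, hTH, hTS⟩ := Finset.subset_set_image_iff.mp hSH
  have hfin : (((H ⊓ f.ker : Subgroup E) : Set E)).Finite :=
    (Set.toFinite (f.ker : Set E)).subset inf_le_right
  have hker : (H ⊓ f.ker).FG :=
    (Subgroup.fg_iff _).mpr ⟨_, Subgroup.closure_eq _, hfin⟩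
  have hT : Subgroup.closure (T : Set E) ≤ H := (Subgroup.closure_le H).mpr hTH
  have hmap : (Subgroup.closure (T : Set E)).map f = H.map f := by
    rw [MonoidHom.map_closure, ← hS, ← hTS, Finset.coe_image]
  have hH : Subgroup.closure (T : Set E) ⊔ (H ⊓ f.ker) = H := by
    refine le_antisymm (sup_le hT inf_le_left) fun x hx ↦ ?_
    obtain ⟨y, hy, hyx⟩ : f x ∈ (Subgroup.closure (T : Set E)).map f :=
      hmap ▸ Subgroup.mem_map_of_mem f hx
    have hmem : y⁻¹ * x ∈ H ⊓ f.ker :=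
      ⟨H.mul_mem (H.inv_mem (hT hy)) hx, by simp [hyx]⟩
    simpa using Subgroup.mul_mem_sup hy hmem
  rw [← hH]
  exact Subgroup.FG.sup ⟨T, rfl⟩ hker

/-- The property that all subgroups are finitely generated descends along surjections. -/
theorem Subgroup.forall_fg_of_surjective {E P : Type*} [Group E] [Group P] (f : E →* P)
    (hf : Function.Surjective f) (hE : ∀ H : Subgroup E, H.FG) (H : Subgroup P) : H.FG := by
  classical
  obtain ⟨S, hS⟩ := hE (H.comap f)
  refine ⟨S.image f, ?_⟩
  rw [Finset.coe_image, ← MonoidHom.map_closure, hS, Subgroup.map_comap_eq_self_of_surjective hf]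

/-- Let `C` be a finite subgroup meeting every nontrivial normal subgroup. If all subgroups are
finitely generated then every abelian normal subgroup is finite. -/
theorem Subgroup.finite_of_normal_of_isMulCommutative {Q : Type*} [Group Q]
    (hQ : ∀ H : Subgroup Q, H.FG) (C : Subgroup Q) [Finite C]
    (hC : ∀ M : Subgroup Q, M.Normal → M ⊓ C = ⊥ → M = ⊥)
    (A : Subgroup Q) [A.Normal] (hA : ∀ a ∈ A, ∀ b ∈ A, a * b = b * a) : Finite A := by
  let : CommGroup A :=
    { (inferInstance : Group A) with
      mul_comm := fun a b ↦ Subtype.ext (hA a a.2 b b.2) }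
  have hfg : ∀ K : Subgroup A, Group.FG K := fun K ↦
    (Group.fg_iff_subgroup_fg K).mpr
      (Subgroup.forall_fg_of_finite_ker A.subtype
        (by rw [A.ker_subtype]; infer_instance) hQ K)
  have : Group.FG A := (Group.fg_iff_subgroup_fg A).mpr (hQ A)
  have : Group.FG (CommGroup.torsion A) := hfg _
  have : Finite (CommGroup.torsion A) :=
    CommGroup.finite_of_fg_isMulTorsion _ CommMonoid.torsion.isMulTorsion
  let t := Nat.card (CommGroup.torsion A)
  have ht0 : 0 < t := Nat.card_pos
  have htors : ∀ a : A, IsOfFinOrder a → a ^ t = 1 := fun a ha ↦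
    congrArg Subtype.val (pow_card_eq_one' (x := (⟨a, ha⟩ : CommGroup.torsion A)))
  let M : Subgroup Q := (powMonoidHom t : A →* A).range.map A.subtype
  have hMnormal : M.Normal := by
    refine ⟨?_⟩
    rintro _ ⟨_, ⟨a, rfl⟩, rfl⟩ g
    refine ⟨_, ⟨⟨g * a * g⁻¹, Subgroup.Normal.conj_mem inferInstance _ a.2 g⟩, rfl⟩, ?_⟩
    simp [conj_pow]
  have hM : M = ⊥ := by
    refine hC M hMnormal (eq_bot_iff.mpr ?_)
    rintro _ ⟨⟨_, ⟨a, rfl⟩, rfl⟩, hxC⟩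
    have h1 : IsOfFinOrder (A.subtype (a ^ t)) := by
      have := isOfFinOrder_of_finite (⟨_, hxC⟩ : C)
      exact Submonoid.isOfFinOrder_coe.mpr this
    have h2 : IsOfFinOrder (a ^ t) := Submonoid.isOfFinOrder_coe.mp h1
    have h3 : IsOfFinOrder a := h2.of_pow ht0.ne'
    simp [htors a h3]
  refine CommGroup.finite_of_fg_isMulTorsion A fun a ↦ ?_
  refine isOfFinOrder_iff_pow_eq_one.mpr ⟨t, ht0, ?_⟩
  have : A.subtype (a ^ t) ∈ M := ⟨_, ⟨a, rfl⟩, rfl⟩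
  rw [hM, Subgroup.mem_bot] at this
  exact Subtype.ext this

/-- A polycyclic group with a finite subgroup meeting every nontrivial normal subgroup is
finite. -/
theorem IsPolycyclic.finite_of_forall_normal {Q : Type*} [Group Q] (hQ : IsPolycyclic Q)
    (C : Subgroup Q) [Finite C]
    (hC : ∀ M : Subgroup Q, M.Normal → M ⊓ C = ⊥ → M = ⊥) : Finite Q := by
  obtain ⟨⟨n, hn⟩, hfg⟩ := hQ
  have key : ∀ k, Finite (derivedSeries Q (n - k)) := by
    intro k
    induction k with
    | zero => rw [Nat.sub_zero, hn]; infer_instance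
    | succ k ih =>
      rcases Nat.lt_or_ge k n with hk | hk
      swap
      · rwa [show n - (k + 1) = n - k by omega]
      obtain ⟨i, hi⟩ : ∃ i, n - (k + 1) = i := ⟨_, rfl⟩
      rw [show n - k = i + 1 by omega] at ih
      rw [hi]
      have hnorm : (derivedSeries Q i).Normal := derivedSeries_normal Q i
      have : Group.FG (derivedSeries Q i) := (Group.fg_iff_subgroup_fg _).mpr (hfg _)
      have : Finite (commutatorSet (derivedSeries Q i)) := by
        refine Finite.of_injective
          (β := derivedSeries Q (i + 1)) (fun x ↦ ⟨x.1.1, ?_⟩) fun x y hxy ↦ ?_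
        · obtain ⟨_, a, b, rfl⟩ := x
          exact Subgroup.commutator_mem_commutator a.2 b.2
        · exact Subtype.ext (Subtype.ext
            (congrArg (fun z : derivedSeries Q (i + 1) ↦ (z : Q)) hxy))
      have : ((Subgroup.center (derivedSeries Q i)).map (derivedSeries Q i).subtype).Normal :=
        ConjAct.normal_of_characteristic_of_normal
      have hfin : Finite
          ((Subgroup.center (derivedSeries Q i)).map (derivedSeries Q i).subtype) := by
        refine Subgroup.finite_of_normal_of_isMulCommutative hfg C hC _ ?_
        rintro _ ⟨a, ha, rfl⟩ _ ⟨b, -, rfl⟩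
        rw [← map_mul, ← map_mul, Subgroup.mem_center_iff.mp ha b]
      have : Finite (Subgroup.center (derivedSeries Q i)) :=
        Finite.of_equiv _ (Subgroup.equivMapOfInjective (Subgroup.center (derivedSeries Q i))
          (derivedSeries Q i).subtype (derivedSeries Q i).subtype_injective).symm.toEquiv
      exact (Subgroup.finite_iff_finite_and_finiteIndex
        (H := Subgroup.center (derivedSeries Q i))).mpr ⟨this, inferInstance⟩
  have := key n
  rw [Nat.sub_self, derivedSeries_zero] at this
  exact Finite.of_equiv _ Subgroup.topEquiv.toEquiv

/-- In a polycyclic group, any finite subgroup meets some subgroup of finite index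
trivially. -/
theorem IsPolycyclic.exists_finiteIndex_inf_eq_bot {E : Type*} [Group E]
    (hE : IsPolycyclic E) (C : Subgroup E) [Finite C] :
    ∃ N : Subgroup E, N.FiniteIndex ∧ N ⊓ C = ⊥ := by
  obtain ⟨N, -, hNmax⟩ := zorn_le_nonempty₀ {N : Subgroup E | N.Normal ∧ N ⊓ C = ⊥}
    (by
      intro c hc hchain N₀ hN₀
      have hmem : ∀ {x : E}, x ∈ sSup c ↔ ∃ s ∈ c, x ∈ s :=
        Subgroup.mem_sSup_of_directedOn ⟨N₀, hN₀⟩ hchain.directedOn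
      refine ⟨sSup c, ⟨⟨fun x hx g ↦ ?_⟩, eq_bot_iff.mpr ?_⟩, fun z hz ↦ le_sSup hz⟩
      · obtain ⟨s, hs, hxs⟩ := hmem.mp hx
        exact hmem.mpr ⟨s, hs, (hc hs).1.conj_mem x hxs g⟩
      · rintro x ⟨hx, hxC⟩
        obtain ⟨s, hs, hxs⟩ := hmem.mp hx
        exact (hc hs).2 ▸ (⟨hxs, hxC⟩ : x ∈ s ⊓ C))
    ⊥ ⟨inferInstance, bot_inf_eq C⟩
  obtain ⟨hN, hNC⟩ := hNmax.prop
  have hsurj := QuotientGroup.mk'_surjective N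
  have : Group.IsSolvable E := hE.1
  have hQ : IsPolycyclic (E ⧸ N) :=
    ⟨(inferInstance : Group.IsSolvable (E ⧸ N)),
      Subgroup.forall_fg_of_surjective (QuotientGroup.mk' N) hsurj hE.2⟩
  have : Finite (C.map (QuotientGroup.mk' N)) :=
    Set.Finite.image (QuotientGroup.mk' N) (Set.toFinite (C : Set E))
  have : Finite (E ⧸ N) := by
    refine hQ.finite_of_forall_normal (C.map (QuotientGroup.mk' N)) fun M hM hMC ↦ ?_
    have hle : N ≤ M.comap (QuotientGroup.mk' N) := by
      intro x hx
      have : QuotientGroup.mk' N x = 1 := (QuotientGroup.eq_one_iff x).mpr hx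
      rw [Subgroup.mem_comap, this]
      exact M.one_mem
    have hbot : M.comap (QuotientGroup.mk' N) ⊓ C = ⊥ := by
      refine eq_bot_iff.mpr ?_
      rintro x ⟨hx, hxC⟩
      have h1 : QuotientGroup.mk' N x ∈ M ⊓ C.map (QuotientGroup.mk' N) :=
        ⟨hx, Subgroup.mem_map_of_mem _ hxC⟩
      rw [hMC, Subgroup.mem_bot] at h1
      exact hNC ▸ (⟨(QuotientGroup.eq_one_iff x).mp h1, hxC⟩ : x ∈ N ⊓ C)
    have hge := hNmax.2 ⟨hM.comap _, hbot⟩ hle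
    rw [eq_bot_iff]
    intro y hy
    obtain ⟨x, rfl⟩ := hsurj y
    exact (QuotientGroup.eq_one_iff x).mpr (hge hy)
  exact ⟨N, Subgroup.finiteIndex_of_finite_quotient, hNC⟩

/-- The underlying set of the central extension of `P` by `A` given by a 2-cocycle `ν`. -/
@[ext]
structure CocycleExtension {P A : Type*} (ν : P → P → A) where
  /-- The coordinate in the kernel. -/
  fiber : A
  /-- The image in the quotient. -/
  base : P

namespace CocycleExtension

variable {P A : Type*} [Group P] [CommGroup A] {ν : P → P → A}

/-- The group structure on the central extension attached to a 2-cocycle. -/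
@[reducible]
def group (hν : ∀ g h k : P, ν h k * ν g (h * k) = ν g h * ν (g * h) k) :
    Group (CocycleExtension ν) :=
  letI : Mul (CocycleExtension ν) :=
    ⟨fun x y ↦ ⟨x.fiber * y.fiber * ν x.base y.base, x.base * y.base⟩⟩
  letI : One (CocycleExtension ν) := ⟨⟨(ν 1 1)⁻¹, 1⟩⟩
  letI : Inv (CocycleExtension ν) :=
    ⟨fun x ↦ ⟨(ν 1 1)⁻¹ * (ν x.base⁻¹ x.base)⁻¹ * x.fiber⁻¹, x.base⁻¹⟩⟩
  Group.ofLeftAxioms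
    (fun x y z ↦ CocycleExtension.ext
      (by
        change x.fiber * y.fiber * ν x.base y.base * z.fiber * ν (x.base * y.base) z.base =
          x.fiber * (y.fiber * z.fiber * ν y.base z.base) * ν x.base (y.base * z.base)
        calc
          _ = x.fiber * y.fiber * z.fiber * (ν x.base y.base * ν (x.base * y.base) z.base) := by
            simp only [mul_comm, mul_left_comm]
          _ = _ := by rw [← hν]; simp only [mul_assoc])
      (mul_assoc _ _ _))
    (fun x ↦ CocycleExtension.ext
      (by
        change (ν 1 1)⁻¹ * x.fiber * ν 1 x.base = x.fiber
        have h := hν 1 1 x.base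
        simp only [one_mul, mul_left_inj] at h
        rw [h, mul_right_comm, inv_mul_cancel, one_mul])
      (one_mul _))
    (fun x ↦ CocycleExtension.ext
      (by
        change (ν 1 1)⁻¹ * (ν x.base⁻¹ x.base)⁻¹ * x.fiber⁻¹ * x.fiber * ν x.base⁻¹ x.base =
          (ν 1 1)⁻¹
        simp)
      (inv_mul_cancel _))

end CocycleExtension

/-- On a polycyclic group, a 2-cocycle with values in a finite group becomes a coboundary on
some subgroup of finite index. -/
theorem IsPolycyclic.exists_finiteIndex_trivialization {P A : Type*} [Group P] [CommGroup A]
    [Finite A] (hP : IsPolycyclic P) (ν : P → P → A)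
    (hν : ∀ g h k : P, ν h k * ν g (h * k) = ν g h * ν (g * h) k) :
    ∃ H : Subgroup P, H.FiniteIndex ∧ ∃ χ : P → A,
      ∀ h ∈ H, ∀ k ∈ H, χ h * χ k * ν h k = χ (h * k) := by
  classical
  let := CocycleExtension.group hν
  let f : CocycleExtension ν →* P := MonoidHom.mk' CocycleExtension.base fun _ _ ↦ rfl
  have hsurj : Function.Surjective f := fun g ↦ ⟨⟨1, g⟩, rfl⟩
  have hker : Finite f.ker := by
    refine Finite.of_injective (fun x : f.ker ↦ x.1.fiber) fun x y hxy ↦ ?_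
    exact Subtype.ext (CocycleExtension.ext hxy (x.2.trans y.2.symm))
  have hcomm : ∀ a b : f.ker, a * b = b * a := by
    rintro ⟨a, ha⟩ ⟨b, hb⟩
    have ha' : a.base = 1 := ha
    have hb' : b.base = 1 := hb
    refine Subtype.ext (CocycleExtension.ext ?_ ?_)
    · change a.fiber * b.fiber * ν a.base b.base = b.fiber * a.fiber * ν b.base a.base
      rw [ha', hb', mul_comm a.fiber]
    · change a.base * b.base = b.base * a.base
      rw [ha', hb']
  have hE : IsPolycyclic (CocycleExtension ν) := by
    have : Group.IsSolvable P := hP.1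
    have : Group.IsSolvable f.ker := Group.isSolvable_of_comm hcomm
    exact ⟨Group.isSolvable_of_ker_le_range f.ker.subtype f (by rw [Subgroup.range_subtype]),
      Subgroup.forall_fg_of_finite_ker f hker hP.2⟩
  obtain ⟨N, hN, hNker⟩ := hE.exists_finiteIndex_inf_eq_bot f.ker
  have hinj : ∀ x ∈ N, ∀ y ∈ N, x.base = y.base → x = y := by
    intro x hx y hy hxy
    have hmem : x * y⁻¹ ∈ N ⊓ f.ker := by
      refine ⟨N.mul_mem hx (N.inv_mem hy), ?_⟩
      change f (x * y⁻¹) = 1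
      rw [map_mul, map_inv, mul_inv_eq_one]
      exact hxy
    rw [hNker, Subgroup.mem_bot] at hmem
    exact mul_inv_eq_one.mp hmem
  have hlift : ∀ g : P, ∃ a : A, g ∈ N.map f → (⟨a, g⟩ : CocycleExtension ν) ∈ N := by
    intro g
    by_cases hg : g ∈ N.map f
    · obtain ⟨x, hx, rfl⟩ := hg
      exact ⟨x.fiber, fun _ ↦ hx⟩
    · exact ⟨1, fun h ↦ absurd h hg⟩
  choose χ hχ using hlift
  refine ⟨N.map f, ⟨?_⟩, χ, fun h hh k hk ↦ ?_⟩
  · exact fun h0 ↦ hN.index_ne_zero (Nat.eq_zero_of_zero_dvd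
      (h0 ▸ Subgroup.index_map_dvd N hsurj))
  · exact congrArg CocycleExtension.fiber
      (hinj _ (N.mul_mem (hχ h hh) (hχ k hk)) _ (hχ _ (Subgroup.mul_mem _ hh hk)) rfl)

namespace Matrix

variable {ι R : Type*} [DecidableEq ι] [CommRing R]

/-- The monomial matrix sending the basis vector `j` to `d j` times the basis vector `σ j`. -/
def monomial (σ : Equiv.Perm ι) (d : ι → R) : Matrix ι ι R :=
  Matrix.of fun i j ↦ if i = σ j then d j else 0

theorem monomial_mul_monomial [Fintype ι] (σ τ : Equiv.Perm ι) (d e : ι → R) :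
    monomial σ d * monomial τ e = monomial (σ * τ) fun j ↦ d (τ j) * e j := by
  ext i j
  simp only [monomial, Matrix.mul_apply, Matrix.of_apply]
  simp
  rfl

theorem smul_monomial (a : R) (σ : Equiv.Perm ι) (d : ι → R) :
    a • monomial σ d = monomial σ fun j ↦ a * d j := by
  ext i j
  simp [monomial]

theorem monomial_one : monomial (1 : Equiv.Perm ι) (fun _ ↦ (1 : R)) = 1 := by
  ext i j
  simp [monomial, Matrix.one_apply]
  rfl

/-- The invertible monomial matrix with unit coefficients. -/
def monomialUnit [Fintype ι] (σ : Equiv.Perm ι) (d : ι → Rˣ) : GL ι R where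
  val := monomial σ fun j ↦ (d j : R)
  inv := monomial σ⁻¹ fun j ↦ ((d (σ⁻¹ j))⁻¹ : Rˣ)
  val_inv := by simp [monomial_mul_monomial, monomial_one]
  inv_val := by simp [monomial_mul_monomial, monomial_one]

end Matrix

/-- A 2-cocycle with values in the units of a commutative ring that becomes a coboundary on a
subgroup of finite index is the obstruction cocycle of an induced projective representation. -/
theorem exists_projective_rep_of_trivialization {G R : Type*} [Group G] [CommRing R]
    (ν : G → G → Rˣ)
    (hν : ∀ g h k : G, ν h k * ν g (h * k) = ν g h * ν (g * h) k)
    (H : Subgroup G) [H.FiniteIndex] (χ : G → Rˣ)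
    (hχ : ∀ h ∈ H, ∀ k ∈ H, χ h * χ k * ν h k = χ (h * k)) :
    ∃ r : ℕ, 1 ≤ r ∧ ∃ ρ : G → GL (Fin r) R, ∀ g h : G,
      (ρ g : Matrix (Fin r) (Fin r) R) * (ρ h : Matrix (Fin r) (Fin r) R) =
        (ν g h : R) • (ρ (g * h) : Matrix (Fin r) (Fin r) R) := by
  classical
  have hout : ∀ x : G, (x : G ⧸ H).out⁻¹ * x ∈ H := fun x ↦
    QuotientGroup.eq.mp (Quotient.out_eq' (x : G ⧸ H))
  let w : G → Rˣ := fun x ↦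
    (ν (x : G ⧸ H).out ((x : G ⧸ H).out⁻¹ * x) * χ ((x : G ⧸ H).out⁻¹ * x))⁻¹
  have hw : ∀ x : G, ∀ h ∈ H, w (x * h) * (ν x h * χ h) = w x := by
    intro x h hh
    have hx : ((x * h : G) : G ⧸ H) = x := by
      rw [QuotientGroup.mk_mul_of_mem x hh]
    have h1 := hν (x : G ⧸ H).out ((x : G ⧸ H).out⁻¹ * x) h
    have h2 := hχ _ (hout x) h hh
    rw [mul_inv_cancel_left, mul_assoc] at h1
    rw [mul_assoc _ x h] at h2
    simp only [w, hx]
    rw [inv_mul_eq_iff_eq_mul, eq_mul_inv_iff_mul_eq, ← h2]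
    simp only [Units.ext_iff, Units.val_mul] at h1 ⊢
    linear_combination -((χ ((x : G ⧸ H).out⁻¹ * x) : R) * χ h) * h1
  let l : G → G → Rˣ := fun g x ↦ ν g x * w (g * x) / w x
  have hl : ∀ g x : G, ∀ h ∈ H, l g (x * h) = l g x := by
    intro g x h hh
    have h1 := hw x h hh
    have h2 := hw (g * x) h hh
    have h3 := hν g x h
    simp only [l]
    rw [← h1, ← h2, ← mul_assoc g x h, div_eq_div_iff_mul_eq_mul]
    simp only [Units.ext_iff, Units.val_mul] at h3 ⊢
    linear_combination (w (g * x * h) * w (x * h) * χ h : R) * h3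
  have hl_mul : ∀ g h x : G, l g (h * x) * l h x = ν g h * l (g * h) x := by
    intro g h x
    have h1 := hν g h x
    simp only [l]
    rw [div_mul_div_comm, ← mul_div_assoc, ← mul_assoc g h x, div_eq_div_iff_mul_eq_mul]
    simp only [Units.ext_iff, Units.val_mul] at h1 ⊢
    linear_combination (w (g * h * x) * w (h * x) * w x : R) * h1
  have hl_coset : ∀ (g : G) (x y : G), (x : G ⧸ H) = y → l g x = l g y := by
    intro g x y hxy
    simpa using (hl g x (x⁻¹ * y) (QuotientGroup.eq.mp hxy)).symm
  let e : G ⧸ H ≃ Fin (Nat.card (G ⧸ H)) := Finite.equivFin _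
  let σ : G → Equiv.Perm (Fin (Nat.card (G ⧸ H))) := fun g ↦
    e.permCongr (MulAction.toPermHom G (G ⧸ H) g)
  refine ⟨Nat.card (G ⧸ H), Nat.card_pos,
    fun g ↦ Matrix.monomialUnit (σ g) fun j ↦ l g (e.symm j).out, fun g h ↦ ?_⟩
  change Matrix.monomial _ _ * Matrix.monomial _ _ = _ • Matrix.monomial _ _
  rw [Matrix.monomial_mul_monomial, Matrix.smul_monomial]
  congr 1
  · ext j
    simp [σ, mul_smul]
  · ext j
    rw [← Units.val_mul, ← Units.val_mul, ← hl_mul]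
    congr 2
    refine hl_coset g _ _ ?_
    rw [QuotientGroup.out_eq']
    simp [σ, ← MulAction.Quotient.mk_smul_out]

/-- If `G` contains a polycyclic subgroup of finite index, then every `ℂˣ`-valued
2-cocycle on `G` (for the trivial action) that is torsion modulo coboundaries is,
up to a coboundary, the obstruction cocycle of a projective representation of `G`. -/
theorem torsion_cocycle_from_projective_rep_of_almost_polycyclic
    (G : Type) [Group G]
    (hG : ∃ P : Subgroup G, IsPolycyclic P ∧ P.FiniteIndex)
    (μ : G → G → ℂˣ)
    (hcocycle : ∀ g h k : G, μ h k * μ g (h * k) = μ g h * μ (g * h) k)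
    (htorsion : ∃ n : ℕ, 0 < n ∧ ∃ c : G → ℂˣ,
      ∀ g h : G, (μ g h) ^ n = c g * c h * (c (g * h))⁻¹) :
    ∃ (r : ℕ), 1 ≤ r ∧ ∃ (ρ : G → GL (Fin r) ℂ) (c : G → ℂˣ),
      ∀ g h : G, ((ρ g : Matrix (Fin r) (Fin r) ℂ) * (ρ h : Matrix (Fin r) (Fin r) ℂ)) =
        ((μ g h * c g * c h * (c (g * h))⁻¹ : ℂˣ) : ℂ) •
          (↑(ρ (g * h)) : Matrix (Fin r) (Fin r) ℂ) := by
  classical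
  obtain ⟨P, hP, hPfin⟩ := hG
  obtain ⟨n, hn, c, hc⟩ := htorsion
  have hroot : ∀ z : ℂˣ, ∃ y : ℂˣ, y ^ n = z := by
    intro z
    obtain ⟨y, hy⟩ := IsAlgClosed.exists_pow_nat_eq (z : ℂ) hn
    have hy0 : y ≠ 0 := by
      rintro rfl
      rw [zero_pow hn.ne'] at hy
      exact z.ne_zero hy.symm
    exact ⟨Units.mk0 y hy0, Units.ext hy⟩
  choose d hd using fun g ↦ hroot (c g)⁻¹
  let ν : G → G → ℂˣ := fun g h ↦ μ g h * d g * d h * (d (g * h))⁻¹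
  have hν : ∀ g h k : G, ν h k * ν g (h * k) = ν g h * ν (g * h) k := by
    intro g h k
    have h1 := hcocycle g h k
    simp only [ν, ← div_eq_mul_inv]
    rw [div_mul_div_comm, div_mul_div_comm, ← mul_assoc g h k, div_eq_div_iff_mul_eq_mul]
    simp only [Units.ext_iff, Units.val_mul, mul_assoc g h k] at h1 ⊢
    linear_combination
      (d g * d h * d k * d (h * k) * d (g * h) * d (g * (h * k)) : ℂ) * h1
  have hνn : ∀ g h : G, ν g h ^ n = 1 := by
    intro g h
    simp only [ν, mul_pow, inv_pow, hd, hc]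
    simp only [Units.ext_iff, Units.val_mul, Units.val_inv_eq_inv_val, Units.val_one]
    field_simp
  have : NeZero n := ⟨hn.ne'⟩
  obtain ⟨H, hH, χ, hχ⟩ := hP.exists_finiteIndex_trivialization
    (fun g h : P ↦ (⟨ν g h, (mem_rootsOfUnity n _).mpr (hνn g h)⟩ : rootsOfUnity n ℂ))
    fun g h k ↦ Subtype.ext (hν g h k)
  have : (H.map P.subtype).FiniteIndex := by
    refine ⟨?_⟩
    rw [Subgroup.index_map_subtype]
    exact mul_ne_zero hH.index_ne_zero hPfin.index_ne_zero
  let χ' : G → ℂˣ := fun g ↦ if hg : g ∈ P then χ ⟨g, hg⟩ else 1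
  have hχ' : ∀ p : P, χ' p = χ p := fun p ↦ dif_pos p.2
  obtain ⟨r, hr, ρ, hρ⟩ := exists_projective_rep_of_trivialization ν hν (H.map P.subtype) χ' (by
      rintro _ ⟨h, hh, rfl⟩ _ ⟨k, hk, rfl⟩
      rw [← map_mul]
      simp only [Subgroup.subtype_apply, hχ']
      exact congrArg Subtype.val (hχ h hh k hk))
  exact ⟨r, hr, ρ, d, hρ⟩
end

section
/- Let a₀, a₁, a₂ be integers with 1 + a₀ + a₁ + a₂ ≠ 0, and let M be the companion matrix with rows (0, 0, −a₀), (1, 0, −a₁), (0, 1, −a₂), regarded as an endomorphism of ℤ³. Then the cokernel ℤ³/(M − I)ℤ³ is a cyclic group of order |1 + a₀ + a₁ + a₂|. -/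
/-- The image of `M - I`, for `M` the companion matrix of `T³ + a₂T² + a₁T + a₀`, consists of the
vectors whose coordinate sum is divisible by `1 + a₀ + a₁ + a₂`. -/
theorem mem_range_companion_sub_one_iff (a₀ a₁ a₂ : ℤ) (v : Fin 3 → ℤ) :
    v ∈ LinearMap.range (Matrix.mulVecLin
      ((!![0, 0, -a₀; 1, 0, -a₁; 0, 1, -a₂] : Matrix (Fin 3) (Fin 3) ℤ) - 1)) ↔
      1 + a₀ + a₁ + a₂ ∣ ∑ i, v i := by
  simp only [LinearMap.mem_range, Matrix.mulVecLin_apply, funext_iff, Fin.forall_fin_succ,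
    Fin.sum_univ_three]
  simp [Matrix.mulVec, dotProduct, Fin.sum_univ_three]
  constructor
  · rintro ⟨w, h₀, h₁, h₂⟩
    exact ⟨-w 2, by linear_combination -h₀ - h₁ - h₂⟩
  · rintro ⟨k, hk⟩
    refine ⟨![-v 0 + a₀ * k, -v 0 + a₀ * k + a₁ * k - v 1, -k], by simp, by simp; ring, ?_⟩
    simp
    linear_combination -hk

/-- The coordinate sum modulo `n`, as a linear map. -/
def coordSumMod (n : ℕ) : (Fin 3 → ℤ) →ₗ[ℤ] ZMod n :=
  (Int.castAddHom (ZMod n)).toIntLinearMap ∘ₗ ∑ i, LinearMap.proj i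

theorem coordSumMod_apply (n : ℕ) (v : Fin 3 → ℤ) :
    coordSumMod n v = ((∑ i, v i : ℤ) : ZMod n) := by
  simp [coordSumMod]

theorem coordSumMod_surjective (n : ℕ) : Function.Surjective (coordSumMod n) := fun x => by
  obtain ⟨k, rfl⟩ := ZMod.intCast_surjective x
  exact ⟨Pi.single 0 k, by rw [coordSumMod_apply]; simp⟩

theorem range_companion_sub_one_eq_ker (a₀ a₁ a₂ : ℤ) :
    LinearMap.range (Matrix.mulVecLin
      ((!![0, 0, -a₀; 1, 0, -a₁; 0, 1, -a₂] : Matrix (Fin 3) (Fin 3) ℤ) - 1)) =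
      LinearMap.ker (coordSumMod (1 + a₀ + a₁ + a₂).natAbs) := by
  ext v
  rw [mem_range_companion_sub_one_iff, LinearMap.mem_ker, coordSumMod_apply,
    ZMod.intCast_zmod_eq_zero_iff_dvd, Int.natAbs_dvd]

/-- Let `M` be the companion matrix with rows `(0,0,−a₀)`, `(1,0,−a₁)`, `(0,1,−a₂)`.
If `1 + a₀ + a₁ + a₂ ≠ 0`, the cokernel `ℤ³/(M − I)ℤ³` is cyclic of order
`|1 + a₀ + a₁ + a₂|`. -/
theorem cokernel_companion_sub_one_cyclic
    (a₀ a₁ a₂ : ℤ) (h : 1 + a₀ + a₁ + a₂ ≠ 0) :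
    IsAddCyclic ((Fin 3 → ℤ) ⧸
        LinearMap.range (Matrix.mulVecLin
          ((!![0, 0, -a₀; 1, 0, -a₁; 0, 1, -a₂] : Matrix (Fin 3) (Fin 3) ℤ) - 1))) ∧
      Nat.card ((Fin 3 → ℤ) ⧸
        LinearMap.range (Matrix.mulVecLin
          ((!![0, 0, -a₀; 1, 0, -a₁; 0, 1, -a₂] : Matrix (Fin 3) (Fin 3) ℤ) - 1))) =
        (1 + a₀ + a₁ + a₂).natAbs := by
  rw [range_companion_sub_one_eq_ker]
  have e := (coordSumMod (1 + a₀ + a₁ + a₂).natAbs).quotKerEquivOfSurjective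
    (coordSumMod_surjective _)
  exact ⟨isAddCyclic_of_surjective e.symm.toAddEquiv e.symm.surjective,
    (Nat.card_congr e.toEquiv).trans (Nat.card_zmod _)⟩
end

section
/- Let π be a group containing a central element z that generates an infinite cyclic subgroup Z ≅ ℤ such that the quotient π/Z is finite. Then for every integer p ≥ 2, the group cohomology H^p(π, ℤ) with trivial π-action on ℤ is a torsion group. -/
universe u

open CategoryTheory

theorem Int.exists_forall_add_one_sub_eq {A : Type*} [AddCommGroup A] (u : ℤ → A) :
    ∃ F : ℤ → A, ∀ n, F (n + 1) - F n = u n := by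
  refine ⟨fun n => ∑ i ∈ Finset.Ico 0 n, u i - ∑ i ∈ Finset.Ico n 0, u i, fun n => ?_⟩
  rcases le_or_gt 0 n with h | h
  · simp [← Finset.insert_Ico_right_eq_Ico_add_one h, Finset.Ico_eq_empty_of_le h,
      Finset.Ico_eq_empty_of_le (h.trans (Int.le_add_one le_rfl))]
  · simp [← Finset.insert_Ico_add_one_left_eq_Ico h, Finset.Ico_eq_empty_of_le h.le,
      Finset.Ico_eq_empty_of_le (Int.add_one_le_of_lt h)]

/-- If `z` has infinite order, the difference operator of left translation by `z` is surjective
on functions. -/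
theorem exists_forall_mul_left_sub_eq {G A : Type*} [Group G] [AddCommGroup A] {z : G}
    (hz : ¬ IsOfFinOrder z) (u : G → A) : ∃ f : G → A, ∀ h, f (z * h) - f h = u h := by
  let s := QuotientGroup.rightRel (Subgroup.zpowers z)
  let r (h : G) : G := Quotient.out (s := s) ⟦h⟧
  have hr (h : G) : ∃ n : ℤ, z ^ n * r h = h := by
    obtain ⟨n, hn⟩ := (Subgroup.mem_zpowers_iff (g := z)).1
      (QuotientGroup.rightRel_apply.1 (Quotient.mk_out h))
    exact ⟨n, hn ▸ inv_mul_cancel_right h _⟩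
  choose n hn using hr
  choose F hF using fun x : G => Int.exists_forall_add_one_sub_eq fun m => u (z ^ m * x)
  have hrz (h : G) : r (z * h) = r h := congrArg Quotient.out <|
    Quotient.sound <| QuotientGroup.rightRel_apply.2 <| by simp
  have hnz (h : G) : n (z * h) = n h + 1 := by
    apply injective_zpow_iff_not_isOfFinOrder.2 hz
    apply mul_right_cancel (b := r h)
    dsimp only
    rw [← hrz h, hn, hrz h, zpow_add_one, (Commute.zpow_self z _).eq, mul_assoc, hn]
  exact ⟨fun h => F (r h) (n h), fun h => by simp only [hrz, hnz, hF, hn]⟩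

namespace Representation

/-- The action of a group on the functions on it by right translation. -/
@[simps]
def rightTranslation (k G A : Type*) [CommRing k] [Group G] [AddCommGroup A] [Module k A] :
    Representation k G (G → A) where
  toFun g := LinearMap.funLeft k A (· * g)
  map_one' := by ext; simp
  map_mul' _ _ := by ext; simp [mul_assoc]

end Representation

namespace Rep

variable (k G A : Type u) [CommRing k] [Group G] [AddCommGroup A] [Module k A]

/-- The `A`-valued functions on `G`, with `G` acting by right translation. -/
noncomputable abbrev functions : Rep k G := of (Representation.rightTranslation k G A)

/-- Functions on `G` are coinduced from the trivial subgroup. -/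
noncomputable def functionsIsoCoind :
    functions k G A ≅ coind (⊥ : Subgroup G).subtype (trivial k (⊥ : Subgroup G) A) :=
  mkIso <| .mk
    { toFun f := ⟨f, fun g h => by simp [Subgroup.mem_bot.1 g.2]⟩
      map_add' _ _ := rfl
      map_smul' _ _ := rfl
      invFun f := f.1
      left_inv _ := rfl
      right_inv _ := rfl } fun _ => rfl

theorem isZero_groupCohomology_functions (n : ℕ) :
    Limits.IsZero (groupCohomology (functions k G A) (n + 1)) :=
  (isZero_groupCohomology_succ_of_subsingleton _ n).of_iso
    ((groupCohomology.functor k G (n + 1)).mapIso (functionsIsoCoind k G A) ≪≫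
      groupCohomology.coindIso _ _)

variable {G}

/-- The functions on `G` invariant under left translation by the subgroup `S`, with `G` acting by
right translation. -/
noncomputable abbrev invariantFunctions (S : Subgroup G) : Rep k G :=
  coind S.subtype (trivial k S A)

/-- The complex `A^(⟨z⟩\G) ⟶ A^G ⟶ A^G` whose second map is the difference operator of left
translation by `z`. -/
noncomputable abbrev differenceShortComplex (z : G) : ShortComplex (Rep k G) where
  X₁ := invariantFunctions k A (Subgroup.zpowers z)
  X₂ := functions k G A
  X₃ := functions k G A
  f := ofHom ⟨Submodule.subtype _, fun _ => rfl⟩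
  g := ofHom ⟨LinearMap.funLeft k A (z * ·) - LinearMap.id, fun g => by
    ext; simp [mul_assoc]⟩
  zero := by
    ext f h
    simpa [sub_eq_zero] using f.2 ⟨z, Subgroup.mem_zpowers z⟩ h

theorem differenceShortComplex_shortExact {z : G} (hz : ¬ IsOfFinOrder z) :
    (differenceShortComplex k A z).ShortExact where
  exact := by
    refine (ShortComplex.exact_map_iff_of_faithful _ (forget₂ (Rep k G) (ModuleCat k))).1
      ((ShortComplex.moduleCat_exact_iff _).2 fun f hf => ⟨⟨f, fun g h => ?_⟩, rfl⟩)
    have hfz (h : G) : f (z * h) = f h := sub_eq_zero.1 (congrFun hf h)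
    obtain ⟨_, n, rfl⟩ := g
    induction n generalizing h with
    | zero => simp
    | succ n ih => simpa [zpow_add_one, mul_assoc, hfz] using ih (z * h)
    | pred n ih => simpa [zpow_sub_one, mul_assoc, hfz, ← hfz (z⁻¹ * h)] using ih (z⁻¹ * h)
  mono_f := (mono_iff_injective _).2 Subtype.val_injective
  epi_g := (epi_iff_surjective _).2 fun u => by
    obtain ⟨f, hf⟩ := exists_forall_mul_left_sub_eq hz u
    exact ⟨f, funext hf⟩

theorem isZero_groupCohomology_invariantFunctions {z : G} (hz : ¬ IsOfFinOrder z) (n : ℕ) :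
    Limits.IsZero (groupCohomology (invariantFunctions k A (Subgroup.zpowers z)) (n + 2)) :=
  (groupCohomology.mapShortComplex₁_exact (differenceShortComplex_shortExact k A hz)
    (rfl : (n + 1) + 1 = n + 2)).isZero_X₂
    ((isZero_groupCohomology_functions k G A n).eq_of_src _ _)
    ((isZero_groupCohomology_functions k G A (n + 1)).eq_of_tgt _ _)

variable (S : Subgroup G)

/-- The inclusion of the constant functions. -/
noncomputable def const : trivial k G A ⟶ invariantFunctions k A S :=
  ofHom ⟨LinearMap.codRestrict _ (LinearMap.pi fun _ => LinearMap.id) fun _ _ _ => rfl,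
    fun _ => rfl⟩

variable {k A S} in
theorem invariantFunctions_apply_eq [S.Normal] (f : invariantFunctions k A S) {a b : G}
    (h : (a : G ⧸ S) = b) : f.1 a = f.1 b := by
  have hab : a * b⁻¹ ∈ S := by
    rw [← QuotientGroup.eq_one_iff]
    simp [h]
  simpa using f.2 ⟨a * b⁻¹, hab⟩ b

/-- Summation over the cosets of a normal subgroup of finite index. -/
noncomputable def sumCosets [S.Normal] [Fintype (G ⧸ S)] :
    invariantFunctions k A S ⟶ trivial k G A :=
  ofHom ⟨(∑ q : G ⧸ S, LinearMap.proj q.out) ∘ₗ Submodule.subtype _, fun g => by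
    ext f
    have h : ∑ q : G ⧸ S, f.1 (q.out * g) = ∑ q : G ⧸ S, f.1 q.out :=
      Fintype.sum_equiv (Equiv.mulRight (g : G ⧸ S)) _ _ fun q =>
        invariantFunctions_apply_eq f (by simp)
    simpa using! h⟩

theorem const_comp_sumCosets [S.Normal] [Fintype (G ⧸ S)] :
    const k A S ≫ sumCosets k A S = Fintype.card (G ⧸ S) • 𝟙 (trivial k G A) := by
  ext a
  simp only [const, sumCosets, nsmul_hom, hom_comp, hom_ofHom]
  exact (LinearMap.sum_apply _ _ _).trans (Finset.sum_const a)

end Rep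

instance groupCohomology.functor_additive (k G : Type u) [CommRing k] [Group G] (n : ℕ) :
    (groupCohomology.functor k G n).Additive :=
  inferInstanceAs ((cochainsFunctor k G ⋙ HomologicalComplex.homologyFunctor _ _ n).Additive)

/-- If `π` has a central element `z` of infinite order such that the quotient by the
cyclic subgroup generated by `z` is finite, then `H^p(π, ℤ)` (trivial action) is a
torsion group for all `p ≥ 2`. -/
theorem groupCohomology_isTorsion_of_central_int_extension
    (π : Type) [Group π] (z : π) (hz : z ∈ Subgroup.center π)
    (hord : ¬ IsOfFinOrder z)
    (hfin : Finite (π ⧸ Subgroup.zpowers z))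
    (p : ℕ) (hp : 2 ≤ p) :
    AddMonoid.IsTorsion (groupCohomology (Rep.trivial ℤ π ℤ) p) := by
  obtain ⟨n, rfl⟩ := Nat.exists_eq_add_of_le' hp
  have : (Subgroup.zpowers z).Normal :=
    ⟨fun x hx g => by
      rwa [Subgroup.mem_center_iff.1 (Subgroup.zpowers_le.2 hz hx) g, mul_inv_cancel_right]⟩
  let _ := Fintype.ofFinite (π ⧸ Subgroup.zpowers z)
  let F := groupCohomology.functor ℤ π (n + 2)
  have hzero : Limits.IsZero (F.obj (Rep.invariantFunctions ℤ ℤ (Subgroup.zpowers z))) :=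
    Rep.isZero_groupCohomology_invariantFunctions ℤ ℤ hord n
  have hF : Fintype.card (π ⧸ Subgroup.zpowers z) • 𝟙 (F.obj (Rep.trivial ℤ π ℤ)) = 0 := by
    rw [← F.map_id, ← F.map_nsmul, ← Rep.const_comp_sumCosets, F.map_comp,
      hzero.eq_of_tgt (F.map _) 0, Limits.zero_comp]
  intro x
  rw [isOfFinAddOrder_iff_nsmul_eq_zero]
  refine ⟨Fintype.card (π ⧸ Subgroup.zpowers z), Fintype.card_pos, ?_⟩
  simpa using! congr($hF x)
end

section
/- Let π be a group containing a central element z that generates an infinite cyclic subgroup Z ≅ ℤ such that the quotient π/Z is finite. Then the group cohomology H³(π, ℤ) with trivial π-action on ℤ is a finite group. -/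
open CategoryTheory Limits Rep

namespace groupCohomology
variable {k G : Type} [CommRing k] [Group G]

/-- A 1-cocycle vanishing on a generating set is zero. -/
lemma cocycles₁_eq_zero_of_closure_eq_top {A : Rep.{0} k G} {s : Set G}
    (hs : Subgroup.closure s = ⊤) (f : cocycles₁ A) (hf : ∀ g ∈ s, f g = 0) : f = 0 := by
  refine cocycles₁_ext fun g ↦ ?_
  change f g = 0
  have hmul := (mem_cocycles₁_iff f.1).1 f.2
  have hg : g ∈ Subgroup.closure s := hs ▸ Subgroup.mem_top g
  induction hg using Subgroup.closure_induction with
  | mem x hx => exact hf x hx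
  | one => exact cocycles₁_map_one f
  | mul x y _ _ hx hy =>
    exact (hmul x y).trans (by simp [hx, hy])
  | inv x _ hx =>
    have := cocycles₁_map_inv f x
    rw [hx, neg_zero] at this
    rw [← A.ρ.inv_self_apply x (f x⁻¹), this, map_zero]

/-- For an infinite cyclic group, a 1-cocycle may take any value on a generator. -/
lemma exists_cocycles₁_apply_eq (A : Rep.{0} k G) {t : G} (ht : ¬ IsOfFinOrder t)
    (hgen : ∀ g, g ∈ Subgroup.zpowers t) (a : A) : ∃ f : cocycles₁ A, f t = a := by
  have hinj : Function.Injective fun n : ℤ ↦ t ^ n := injective_zpow_iff_not_isOfFinOrder.2 ht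
  choose l hl using fun g ↦ Subgroup.mem_zpowers_iff.1 (hgen g)
  have hl_mul (g h : G) : l (g * h) = l g + l h := hinj <| by simp [hl, zpow_add]
  have hl_t : l t = 1 := hinj <| by simp [hl]
  let e : Equiv.Perm A :=
    { toFun := fun x ↦ A.ρ t x + a
      invFun := fun x ↦ A.ρ t⁻¹ (x - a)
      left_inv := fun x ↦ by simp
      right_inv := fun x ↦ by simp }
  have he (n : ℤ) : ∀ x, (e ^ n) x = A.ρ (t ^ n) x + (e ^ n) 0 := by
    induction n with
    | zero => simp
    | succ n ih =>
      intro x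
      have h1 (y : A) : e y = A.ρ t y + a := rfl
      have h2 : A.ρ (t ^ ((n : ℤ) + 1)) x = A.ρ t (A.ρ (t ^ (n : ℤ)) x) := by
        rw [add_comm, zpow_add, zpow_one, map_mul]; rfl
      rw [add_comm (n : ℤ) 1, zpow_add, zpow_one, Equiv.Perm.mul_apply, Equiv.Perm.mul_apply, h1, h1,
        ih x, add_comm 1 (n : ℤ), h2, map_add]
      abel
    | pred n ih =>
      intro x
      have h1 (y : A) : e⁻¹ y = A.ρ t⁻¹ (y - a) := rfl
      have h2 : A.ρ (t ^ (-(n : ℤ) - 1)) x = A.ρ t⁻¹ (A.ρ (t ^ (-(n : ℤ))) x) := by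
        rw [sub_eq_neg_add, zpow_add, zpow_neg_one, map_mul]; rfl
      rw [sub_eq_neg_add (-(n : ℤ)) 1, zpow_add, zpow_neg_one, Equiv.Perm.mul_apply,
        Equiv.Perm.mul_apply, h1, h1, ih x, ← sub_eq_neg_add, h2, add_sub_assoc, map_add]
  refine ⟨⟨fun g ↦ (e ^ l g) 0, (mem_cocycles₁_iff _).2 fun g h ↦ ?_⟩, ?_⟩
  · rw [hl_mul, zpow_add, Equiv.Perm.mul_apply, he, hl]
  · change (e ^ l t) 0 = a
    simp [hl_t, e]

/-- For an infinite cyclic group, `H¹` preserves epimorphisms. -/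
lemma epi_map_one_of_zpowers {A B : Rep.{0} k G} (φ : A ⟶ B) [Epi φ] {t : G}
    (ht : ¬ IsOfFinOrder t) (hgen : ∀ g, g ∈ Subgroup.zpowers t) :
    Epi (map (MonoidHom.id G) φ 1) := by
  rw [ModuleCat.epi_iff_surjective]
  intro y
  induction y using H1_induction_on with | h y =>
  obtain ⟨a, ha⟩ := (Rep.epi_iff_surjective φ).1 ‹_› (y t)
  obtain ⟨f, hf⟩ := exists_cocycles₁_apply_eq A ht hgen a
  have hcl : Subgroup.closure {t} = ⊤ := by
    rw [← Subgroup.zpowers_eq_closure, Subgroup.eq_top_iff']; exact hgen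
  refine ⟨H1π A f, ?_⟩
  have h : mapCocycles₁ (MonoidHom.id G) φ f = y := by
    rw [← sub_eq_zero]
    refine cocycles₁_eq_zero_of_closure_eq_top hcl _ ?_
    intro g hg
    rw [Set.mem_singleton_iff.1 hg]
    change φ.hom (f t) - y t = 0
    rw [hf, ha, sub_self]
  rw [← h]
  exact congr($(H1π_comp_map (MonoidHom.id G) φ) f)

lemma isZero_X₁_of_epi_map {X : ShortComplex (Rep.{0} k G)} (hX : X.ShortExact) (n : ℕ)
    [Epi (map (MonoidHom.id G) X.g n)] (h : IsZero (groupCohomology X.X₂ (n + 1))) :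
    IsZero (groupCohomology X.X₁ (n + 1)) := by
  have := epi_δ_of_isZero hX n h
  have h0 : map (MonoidHom.id G) X.g n ≫ δ hX n (n + 1) rfl = 0 :=
    (map_cochainsFunctor_shortExact hX).comp_δ n (n + 1) rfl
  exact IsZero.of_epi_eq_zero (δ hX n (n + 1) rfl) (zero_of_epi_comp _ h0)

/-- The short complex `A ⟶ coind (res A) ⟶ coker`. -/
noncomputable abbrev coindShortComplex (S : Subgroup G) (A : Rep.{0} k G) :
    ShortComplex (Rep.{0} k G) :=
  ShortComplex.mk (resCoindToHom S.subtype A (res S.subtype A) (𝟙 _)) (cokernel.π _)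
    (cokernel.condition _)

lemma coindShortComplex_shortExact (S : Subgroup G) (A : Rep.{0} k G) :
    (coindShortComplex S A).ShortExact where
  exact := ShortComplex.exact_cokernel _
  mono_f := by
    rw [Rep.mono_iff_injective]
    intro a b h
    have h1 := congr_fun (congrArg Subtype.val h) 1
    simpa [resCoindToHom] using h1
  epi_g := inferInstance

lemma isZero_coind_bot (A : Rep.{0} k (⊥ : Subgroup G)) (n : ℕ) :
    IsZero (groupCohomology (coind (⊥ : Subgroup G).subtype A) (n + 1)) :=
  (isZero_groupCohomology_succ_of_subsingleton A n).of_iso (groupCohomology.coindIso A (n + 1))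

/-- The cohomology of an infinite cyclic group vanishes in degrees at least 2. -/
lemma isZero_of_zpowers {t : G} (ht : ¬ IsOfFinOrder t)
    (hgen : ∀ g, g ∈ Subgroup.zpowers t) (n : ℕ) (A : Rep.{0} k G) :
    IsZero (groupCohomology A (n + 2)) := by
  have hX := coindShortComplex_shortExact ⊥ A
  have hX₂ := isZero_coind_bot (res (⊥ : Subgroup G).subtype A) (n + 1)
  cases n with
  | zero =>
    have := hX.epi_g
    have := epi_map_one_of_zpowers (coindShortComplex ⊥ A).g ht hgen
    exact isZero_X₁_of_epi_map hX 1 hX₂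
  | succ n =>
    have := epi_δ_of_isZero hX (n + 2) hX₂
    exact (isZero_of_zpowers ht hgen n _).of_epi (δ hX (n + 2) (n + 3) rfl)

instance finite_coind [IsNoetherianRing k] (S : Subgroup G) [S.FiniteIndex] (A : Rep.{0} k S)
    [Module.Finite k A] : Module.Finite k (coind S.subtype A) := by
  let F : A.ρ.coindV S.subtype →ₗ[k] (G ⧸ S → A) :=
    LinearMap.pi fun q ↦ LinearMap.proj (q.out⁻¹) ∘ₗ (A.ρ.coindV S.subtype).subtype
  refine Module.Finite.of_injective F ?_
  rw [injective_iff_map_eq_zero]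
  intro f hf
  refine Subtype.ext <| funext fun g ↦ ?_
  obtain ⟨s, hs⟩ := QuotientGroup.mk_out_eq_mul S g⁻¹
  have h := f.2 s (((g⁻¹ : G) : G ⧸ S).out⁻¹)
  have h0 : f.1 (((g⁻¹ : G) : G ⧸ S).out⁻¹) = 0 := congr_fun hf _
  rw [h0, map_zero, hs] at h
  simpa using h

/-- `H¹` of a finitely generated group with finitely generated coefficients is finitely generated. -/
instance finite_one [IsNoetherianRing k] [Group.FG G] (A : Rep.{0} k G) [Module.Finite k A] :
    Module.Finite k (groupCohomology A 1) := by
  obtain ⟨s, hs, hfin⟩ := Group.fg_iff.1 ‹Group.FG G›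
  have := hfin.to_subtype
  let F : cocycles₁ A →ₗ[k] (s → A) :=
    LinearMap.pi fun g ↦ LinearMap.proj g.1 ∘ₗ (cocycles₁ A).subtype
  have : Module.Finite k (cocycles₁ A) := by
    refine Module.Finite.of_injective F ((injective_iff_map_eq_zero _).2 fun f hf ↦ ?_)
    exact cocycles₁_eq_zero_of_closure_eq_top hs f fun g hg ↦ congr_fun hf ⟨g, hg⟩
  exact Module.Finite.of_surjective (H1π A).hom
    ((ModuleCat.epi_iff_surjective (H1π A)).1 inferInstance)

lemma isZero_coind_zpowers {t : G} (ht : ¬ IsOfFinOrder t)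
    (A : Rep.{0} k (Subgroup.zpowers t)) (n : ℕ) :
    IsZero (groupCohomology (coind (Subgroup.zpowers t).subtype A) (n + 2)) := by
  refine (isZero_of_zpowers (t := ⟨t, Subgroup.mem_zpowers t⟩) ?_ ?_ n A).of_iso
    (groupCohomology.coindIso A (n + 2))
  · rwa [← Submonoid.isOfFinOrder_coe]
  · rintro ⟨_, m, rfl⟩
    exact ⟨m, rfl⟩

/-- The positive degree cohomology of a virtually infinite cyclic group with finitely generated
coefficients is finitely generated. -/
theorem finite_of_zpowers_finiteIndex [IsNoetherianRing k] [Group.FG G] {t : G}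
    (ht : ¬ IsOfFinOrder t) [(Subgroup.zpowers t).FiniteIndex] (n : ℕ) (A : Rep.{0} k G)
    [Module.Finite k A] : Module.Finite k (groupCohomology A (n + 1)) := by
  induction n generalizing A with
  | zero => exact finite_one A
  | succ n ih =>
    have hX := coindShortComplex_shortExact (Subgroup.zpowers t) A
    have := epi_δ_of_isZero hX (n + 1)
      (isZero_coind_zpowers ht (res (Subgroup.zpowers t).subtype A) n)
    have : Module.Finite k (res (Subgroup.zpowers t).subtype A) := ‹Module.Finite k A›
    have hfin : Module.Finite k (coindShortComplex (Subgroup.zpowers t) A).X₂ :=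
      finite_coind (Subgroup.zpowers t) (res (Subgroup.zpowers t).subtype A)
    have hX₃ : Module.Finite k (coindShortComplex (Subgroup.zpowers t) A).X₃ :=
      Module.Finite.of_surjective (coindShortComplex (Subgroup.zpowers t) A).g.hom.toLinearMap
        ((Rep.epi_iff_surjective _).1 hX.epi_g)
    have := ih (coindShortComplex (Subgroup.zpowers t) A).X₃
    exact Module.Finite.of_surjective (δ hX (n + 1) (n + 2) rfl).hom
      ((ModuleCat.epi_iff_surjective _).1 inferInstance)

attribute [local instance] Subgroup.fintypeQuotientOfFiniteIndex

/-- For `f` in the coinduction of `res A`, the value `x • f(x⁻¹)` only depends on the coset of `x`. -/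
def coindQuotientEval (S : Subgroup G) (A : Rep.{0} k G) (q : G ⧸ S) :
    (res S.subtype A).ρ.coindV S.subtype →ₗ[k] A where
  toFun f := Quotient.liftOn' q (fun x ↦ A.ρ x (f.1 x⁻¹)) fun x y h ↦ by
    rw [QuotientGroup.leftRel_apply] at h
    have hf : f.1 x⁻¹ = A.ρ (x⁻¹ * y) (f.1 y⁻¹) := by
      have := f.2 ⟨x⁻¹ * y, h⟩ y⁻¹
      simpa using this
    change A.ρ x (f.1 x⁻¹) = A.ρ y (f.1 y⁻¹)
    rw [hf, map_mul, Module.End.mul_apply, Representation.self_inv_apply]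
  map_add' f g := by
    induction q using Quotient.inductionOn' with | h x =>
    exact map_add (A.ρ x) _ _
  map_smul' r f := by
    induction q using Quotient.inductionOn' with | h x =>
    exact map_smul (A.ρ x) _ _

/-- The trace `coind (res A) ⟶ A` for a finite index subgroup `S`, sending `f` to the sum over
`x : G ⧸ S` of `x • f(x⁻¹)`. -/
noncomputable def coindTrace (S : Subgroup G) [S.FiniteIndex] (A : Rep.{0} k G) :
    coind S.subtype (res S.subtype A) ⟶ A :=
  Rep.ofHom ⟨∑ q : G ⧸ S, coindQuotientEval S A q, fun g ↦ by
    ext f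
    simp only [LinearMap.comp_apply, LinearMap.sum_apply, map_sum]
    refine (Fintype.sum_equiv (MulAction.toPerm g) _ _ fun q ↦ ?_).symm
    induction q using Quotient.inductionOn' with | h x =>
    change A.ρ g (A.ρ x (f.1 x⁻¹)) = A.ρ (g * x) (f.1 ((g * x)⁻¹ * g))
    simp⟩

lemma unit_comp_coindTrace (S : Subgroup G) [S.FiniteIndex] (A : Rep.{0} k G) :
    resCoindToHom S.subtype A (res S.subtype A) (𝟙 _) ≫ coindTrace S A = S.index • 𝟙 A := by
  ext a
  have h (q : G ⧸ S) : coindQuotientEval S A q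
      ((resCoindToHom S.subtype A (res S.subtype A) (𝟙 _)).hom a) = a := by
    induction q using Quotient.inductionOn' with | h x =>
    exact A.ρ.self_inv_apply x a
  change (∑ q : G ⧸ S, coindQuotientEval S A q)
      ((resCoindToHom S.subtype A (res S.subtype A) (𝟙 _)).hom a) = S.index • a
  simp only [LinearMap.sum_apply, h, Finset.sum_const, Finset.card_univ]
  rw [Subgroup.index_eq_card, Nat.card_eq_fintype_card]

/-- In degrees at least 2, the cohomology of a group is annihilated by the index of any infinite
cyclic subgroup of finite index. -/
lemma index_smul_eq_zero {t : G} (ht : ¬ IsOfFinOrder t) [(Subgroup.zpowers t).FiniteIndex]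
    (n : ℕ) (A : Rep.{0} k G) (x : groupCohomology A (n + 2)) :
    (Subgroup.zpowers t).index • x = 0 := by
  have h := congr((functor k G (n + 2)).map $(unit_comp_coindTrace (Subgroup.zpowers t) A))
  have h0 : (functor k G (n + 2)).map (resCoindToHom (Subgroup.zpowers t).subtype A
      (res (Subgroup.zpowers t).subtype A) (𝟙 _)) = 0 :=
    (isZero_coind_zpowers ht (res (Subgroup.zpowers t).subtype A) n).eq_of_tgt _ _
  have hs (m : ℕ) : (functor k G (n + 2)).map (m • 𝟙 A) = m • 𝟙 _ := by
    change (HomologicalComplex.homologyFunctor _ _ (n + 2)).map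
      ((cochainsFunctor k G).map (m • 𝟙 A)) = _
    rw [Functor.map_nsmul, Functor.map_nsmul]
    exact congrArg (m • ·) ((functor k G (n + 2)).map_id A)
  rw [Functor.map_comp, h0, zero_comp, hs] at h
  exact congr($h.symm x)

end groupCohomology

/-- A group with a finitely generated subgroup of finite index is finitely generated. -/
theorem Group.fg_of_fg_finiteIndex {G : Type*} [Group G] (S : Subgroup G) [S.FiniteIndex]
    (hS : S.FG) : Group.FG G := by
  have : Finite (G ⧸ S) := S.finite_quotient_of_finiteIndex
  obtain ⟨T, hT, hfin⟩ := (Subgroup.fg_iff S).1 hS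
  refine Group.fg_iff.2 ⟨T ∪ Set.range (Quotient.out : G ⧸ S → G),
    (Subgroup.eq_top_iff' _).2 fun g ↦ ?_, hfin.union (Set.finite_range _)⟩
  obtain ⟨s, hs⟩ := QuotientGroup.mk_out_eq_mul S g
  rw [← mul_inv_eq_iff_eq_mul.2 hs]
  refine mul_mem (Subgroup.subset_closure (Or.inr ⟨_, rfl⟩)) (inv_mem ?_)
  exact Subgroup.closure_mono Set.subset_union_left (hT ▸ s.2)

/-- If `π` has a central element `z` of infinite order such that the quotient by the
cyclic subgroup generated by `z` is finite, then `H³(π, ℤ)` (trivial action) is a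
finite group. -/
theorem groupCohomology_three_finite_of_central_int_extension
    (π : Type) [Group π] (z : π) (hz : z ∈ Subgroup.center π)
    (hord : ¬ IsOfFinOrder z)
    (hfin : Finite (π ⧸ Subgroup.zpowers z)) :
    Finite (groupCohomology (Rep.trivial ℤ π ℤ) 3) := by
  have : (Subgroup.zpowers z).FiniteIndex := Subgroup.finiteIndex_of_finite_quotient
  have : Group.FG π := Group.fg_of_fg_finiteIndex (Subgroup.zpowers z)
    ⟨{z}, by simp [Subgroup.zpowers_eq_closure]⟩
  have : Module.Finite ℤ (groupCohomology (Rep.trivial ℤ π ℤ) 3) :=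
    groupCohomology.finite_of_zpowers_finiteIndex hord 2 _
  refine Module.finite_of_fg_torsion _ fun x ↦ ⟨⟨(Subgroup.zpowers z).index, ?_⟩, ?_⟩
  · exact mem_nonZeroDivisors_of_ne_zero (mod_cast Subgroup.FiniteIndex.index_ne_zero)
  · exact (Nat.cast_smul_eq_nsmul ℤ _ x).trans
      (groupCohomology.index_smul_eq_zero hord 1 _ x)
end
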